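/- arXiv:1709.06168 — 2 statements merged into one kernel-verified Lean document; each statement's English description precedes it below -/
import Mathlib

section
/- Let q be a prime and let t be an integer with gcd(t, q) = 1. Then ŝ_q(t) = −(1/(πi·φ(q))) Σ_{χ ≠ χ₀ mod q} conj(χ(t)) L(0,χ) L(1,χ), and also ŝ_q(t) = (1/(πi)) Σ_{n ≥ 1, gcd(n,q)=1} ψ(t·n̄/q)/n, where n̄ denotes the multiplicative inverse of n mod q and the infinite series converges (as the limit of its partial sums). -/
open scoped Classical Real
open Complex MeasureTheory

/-- The sawtooth function `ψ`. -/
noncomputable def saw (x : ℝ) : ℝ := if Int.fract x = 0 then 0 else Int.fract x - 1/2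

/-- The Dedekind sum `s_q(a)`. -/
noncomputable def dedekindSum (q : ℕ) (a : ℤ) : ℝ :=
  ∑ x ∈ Finset.range q, saw ((x : ℝ) / q) * saw ((a * x : ℝ) / q)

/-- The discrete Fourier transform `ŝ_q(t)` of the Dedekind sum. -/
noncomputable def shat (q : ℕ) (t : ℤ) : ℂ :=
  (1 / (q : ℂ)) * ∑ a ∈ Finset.range q,
    (dedekindSum q a : ℂ) * Complex.exp (2 * Real.pi * Complex.I * (a * t) / q)

/-- The least nonnegative residue of the multiplicative inverse of `n` mod `q`. -/
noncomputable def invMod (q n : ℕ) : ℕ := ZMod.val ((n : ZMod q)⁻¹)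

/-- The character sum `∑_{χ ≠ χ₀ mod q} conj(χ(t)) L(0,χ) L(1,χ)`. -/
noncomputable def Lsum (q : ℕ) (t : ℤ) : ℂ :=
  if h : q = 0 then 0 else
    haveI : NeZero q := ⟨h⟩
    ∑ χ ∈ Finset.univ.filter (fun χ : DirichletCharacter ℂ q => χ ≠ 1),
      (starRingEnd ℂ) (χ ((t : ZMod q))) * DirichletCharacter.LFunction χ 0 *
        DirichletCharacter.LFunction χ 1

theorem rpow_neg_sub_rpow_neg_le {c x y s : ℝ} {n : ℕ} (hc : 0 < c) (hc1 : c ≤ 1)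
    (hx : c * (n + 1) ≤ x) (hxy : x ≤ y) (hyx : y ≤ x + 1) (hs : s ∈ Set.Icc (1 : ℝ) 2) :
    |1 / x ^ s - 1 / y ^ s| ≤ 2 / c ^ 3 * (1 / ((n : ℝ) + 1) ^ 2) := by
  have hn : (0 : ℝ) < n + 1 := by positivity
  have hx0 : 0 < x := lt_of_lt_of_le (by positivity) hx
  have hy0 : 0 < y := hx0.trans_le hxy
  have hs0 : 0 ≤ s := by linarith [hs.1]
  have hbern : 1 - s * ((y - x) / y) ≤ (x / y) ^ s := by
    have h := one_add_mul_self_le_rpow_one_add (s := (x - y) / y) (p := s) (by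
      rw [le_div_iff₀ hy0]; linarith) hs.1
    have h1 : 1 + (x - y) / y = x / y := by field_simp; ring
    rw [h1] at h
    calc 1 - s * ((y - x) / y) = 1 + s * ((x - y) / y) := by ring
      _ ≤ _ := h
  have hle : 1 / y ^ s ≤ 1 / x ^ s :=
    one_div_le_one_div_of_le (by positivity) (Real.rpow_le_rpow hx0.le hxy hs0)
  have hxs : c ^ 2 * (n + 1) ≤ x ^ s := by
    calc c ^ 2 * (n + 1) ≤ c ^ s * ((n : ℝ) + 1) ^ s := by
          gcongr
          · rw [← Real.rpow_natCast]
            exact Real.rpow_le_rpow_of_exponent_ge hc hc1 (by exact_mod_cast hs.2)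
          · simpa using Real.rpow_le_rpow_of_exponent_le (x := (n : ℝ) + 1) (by simp) hs.1
      _ = (c * (n + 1)) ^ s := (Real.mul_rpow hc.le hn.le).symm
      _ ≤ x ^ s := Real.rpow_le_rpow (by positivity) hx hs0
  rw [abs_of_nonneg (sub_nonneg.2 hle)]
  have hfac : 1 / x ^ s - 1 / y ^ s = (1 - (x / y) ^ s) * (1 / x ^ s) := by
    rw [Real.div_rpow hx0.le hy0.le]
    have := (Real.rpow_pos_of_pos hx0 s).ne'
    field_simp
  rw [hfac]
  calc (1 - (x / y) ^ s) * (1 / x ^ s) ≤ (2 * (1 / (c * (n + 1)))) * (1 / (c ^ 2 * (n + 1))) := by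
        gcongr
        calc 1 - (x / y) ^ s ≤ s * ((y - x) / y) := by linarith
          _ ≤ 2 * (1 / (c * (n + 1))) := by
            gcongr
            · exact hs.2
            · linarith
            · linarith
    _ = _ := by field_simp

/-- The Dirichlet series of the odd Hurwitz zeta function still converges at `s = 1`. -/
theorem hasSum_hurwitzZetaOdd_one {a : ℝ} (ha : a ∈ Set.Ioo (0 : ℝ) 1) :
    HasSum (fun n : ℕ ↦ (1 / (n + a : ℂ) - 1 / (n + 1 - a : ℂ)) / 2)
      (HurwitzZeta.hurwitzZetaOdd a 1) := by
  obtain ⟨ha0, ha1⟩ := ha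
  let f : ℕ → ℝ → ℝ := fun n s ↦ (1 / (n + a) ^ s - 1 / (n + 1 - a) ^ s) / 2
  have hpos1 (n : ℕ) : 0 < n + a := by positivity
  have hpos2 (n : ℕ) : 0 < n + 1 - a := by have : (0 : ℝ) ≤ n := n.cast_nonneg; linarith
  set c : ℝ := min a (1 - a) with hc
  have hc0 : 0 < c := lt_min ha0 (by linarith)
  have hca : c ≤ a := min_le_left _ _
  have hca' : c ≤ 1 - a := min_le_right _ _
  have hu : Summable fun n : ℕ ↦ 2 / c ^ 3 * (1 / ((n : ℝ) + 1) ^ 2) := by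
    refine Summable.mul_left _ ?_
    have := (summable_nat_add_iff 1).2 (Real.summable_one_div_nat_pow.2 one_lt_two)
    simpa using this
  have hbound (n : ℕ) (s : ℝ) (hs : s ∈ Set.Icc (1 : ℝ) 2) :
      ‖f n s‖ ≤ 2 / c ^ 3 * (1 / ((n : ℝ) + 1) ^ 2) := by
    have hn : (0 : ℝ) ≤ n := n.cast_nonneg
    have h : |1 / (n + a) ^ s - 1 / (n + 1 - a) ^ s| ≤ 2 / c ^ 3 * (1 / ((n : ℝ) + 1) ^ 2) := by
      rcases le_total (n + a) (n + 1 - a) with h | h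
      · exact rpow_neg_sub_rpow_neg_le hc0 (by linarith) (by nlinarith) h (by linarith) hs
      · rw [abs_sub_comm]
        exact rpow_neg_sub_rpow_neg_le hc0 (by linarith) (by nlinarith) h (by linarith) hs
    simp only [f, norm_div, Real.norm_eq_abs, Nat.abs_ofNat]
    linarith [abs_nonneg (1 / (n + a) ^ s - 1 / (n + 1 - a) ^ s)]
  have hcont : ContinuousOn (fun s ↦ ∑' n, f n s) (Set.Icc 1 2) := by
    refine continuousOn_tsum (fun n ↦ ?_) hu hbound
    refine Continuous.continuousOn ?_
    have h1 := (hpos1 n).ne'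
    have h2 := (hpos2 n).ne'
    simp only [f]
    refine Continuous.div_const (Continuous.sub ?_ ?_) _
    · exact continuous_const.div (continuous_const.rpow continuous_id fun _ ↦ .inl h1)
        fun s ↦ (Real.rpow_pos_of_pos (hpos1 n) s).ne'
    · exact continuous_const.div (continuous_const.rpow continuous_id fun _ ↦ .inl h2)
        fun s ↦ (Real.rpow_pos_of_pos (hpos2 n) s).ne'
  have hsum (s : ℝ) (hs : s ∈ Set.Icc (1 : ℝ) 2) : Summable fun n ↦ f n s :=
    .of_norm_bounded hu fun n ↦ hbound n s hs
  have hcast (n : ℕ) (s : ℝ) : (1 / (n + a : ℂ) ^ (s : ℂ) - 1 / (n + 1 - a : ℂ) ^ (s : ℂ)) / 2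
      = (f n s : ℂ) := by
    simp only [f]
    push_cast [ofReal_cpow (hpos1 n).le, ofReal_cpow (hpos2 n).le]
    rfl
  have heq (s : ℝ) (hs : s ∈ Set.Ioc (1 : ℝ) 2) :
      HurwitzZeta.hurwitzZetaOdd a s = ((∑' n, f n s : ℝ) : ℂ) := by
    have h := HurwitzZeta.hasSum_nat_hurwitzZetaOdd_of_mem_Icc (a := a) ⟨ha0.le, ha1.le⟩
      (s := s) (by simpa using hs.1)
    simp only [hcast] at h
    rw [← h.tsum_eq, ofReal_tsum]
  have hlim1 : Filter.Tendsto (fun s : ℝ ↦ HurwitzZeta.hurwitzZetaOdd a s)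
      (nhdsWithin 1 (Set.Ioc 1 2)) (nhds (HurwitzZeta.hurwitzZetaOdd a 1)) := by
    have h : Continuous fun s : ℝ ↦ HurwitzZeta.hurwitzZetaOdd a s :=
      (HurwitzZeta.differentiable_hurwitzZetaOdd a).continuous.comp continuous_ofReal
    have := h.tendsto 1
    rw [ofReal_one] at this
    exact this.mono_left nhdsWithin_le_nhds
  have hlim2 : Filter.Tendsto (fun s : ℝ ↦ HurwitzZeta.hurwitzZetaOdd a s)
      (nhdsWithin 1 (Set.Ioc 1 2)) (nhds ((∑' n, f n 1 : ℝ) : ℂ)) := by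
    have h := (hcont 1 (by simp)).mono Set.Ioc_subset_Icc_self
    refine ((continuous_ofReal.tendsto _).comp h.tendsto).congr' ?_
    filter_upwards [self_mem_nhdsWithin] with s hs
    exact (heq s hs).symm
  have hne : (nhdsWithin (1 : ℝ) (Set.Ioc 1 2)).NeBot := by
    rw [nhdsWithin_Ioc_eq_nhdsGT one_lt_two]; infer_instance
  rw [tendsto_nhds_unique hlim1 hlim2]
  have := hasSum_ofReal.2 (hsum 1 (by simp)).hasSum
  refine this.congr_fun fun n ↦ ?_
  rw [← hcast]
  simp

theorem hurwitzZetaOdd_one {a : ℝ} (ha : a ∈ Set.Ioo (0 : ℝ) 1) :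
    HurwitzZeta.hurwitzZetaOdd a 1 = π / 2 * cot (π * a) := by
  have hmem : (a : ℂ) ∈ Complex.integerComplement := by
    rintro ⟨m, hm⟩
    have hm' : (m : ℝ) = a := by exact_mod_cast hm
    have h0 : (0 : ℝ) < m := hm' ▸ ha.1
    have h1 : (m : ℝ) < 1 := hm' ▸ ha.2
    norm_cast at h0 h1
    lia
  have h := (hasSum_hurwitzZetaOdd_one ha).tendsto_sum_nat
  refine tendsto_nhds_unique h ?_
  have hpart (N : ℕ) : ∑ n ∈ Finset.range N, (1 / (n + a : ℂ) - 1 / (n + 1 - a : ℂ)) / 2 =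
      (1 / a + ∑ n ∈ Finset.range N, cotTerm a n - 1 / (a + N)) / 2 := by
    induction N with
    | zero => simp
    | succ N ih =>
      rw [Finset.sum_range_succ, Finset.sum_range_succ, ih, cotTerm,
        show (N + 1 - a : ℂ) = -(a - (N + 1)) by ring]
      push_cast
      rw [one_div_neg_eq_neg_one_div]
      ring
  simp only [hpart]
  have h0 : Filter.Tendsto (fun N : ℕ ↦ 1 / ((a : ℂ) + N)) Filter.atTop (nhds 0) := by
    have h : Filter.Tendsto (fun N : ℕ ↦ (a + N)⁻¹) Filter.atTop (nhds 0) :=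
      tendsto_inv_atTop_zero.comp
        (Filter.tendsto_atTop_add_const_left _ a tendsto_natCast_atTop_atTop)
    simpa [Function.comp_def] using (continuous_ofReal.tendsto 0).comp h
  have := (((tendsto_logDeriv_euler_cot_sub hmem).const_add (1 / (a : ℂ))).sub h0).div_const 2
  convert this using 2
  ring

theorem hurwitzZetaOdd_toAddCircle_one {q : ℕ} [NeZero q] (c : ZMod q) :
    HurwitzZeta.hurwitzZetaOdd (ZMod.toAddCircle c) 1 = π / 2 * cot (π * (c.val / q)) := by
  rcases eq_or_ne c 0 with rfl | hc
  · have h := HurwitzZeta.hurwitzZetaOdd_neg 0 1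
    rw [neg_zero, CharZero.eq_neg_self_iff] at h
    simp [h, cot]
  · have hq : (0 : ℝ) < q := Nat.cast_pos.2 (NeZero.pos q)
    have hv : 0 < c.val := ZMod.val_pos.2 hc
    rw [ZMod.toAddCircle_apply, hurwitzZetaOdd_one ⟨by positivity, ?_⟩]
    · push_cast; rfl
    · rw [div_lt_one hq]; exact_mod_cast c.val_lt

theorem ZMod.sum_range_eq_sum_val {M : Type*} [AddCommMonoid M] (q : ℕ) [NeZero q] (g : ℕ → M) :
    ∑ x ∈ Finset.range q, g x = ∑ c : ZMod q, g c.val := by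
  refine Finset.sum_nbij' (fun x ↦ (x : ZMod q)) ZMod.val (by simp)
    (fun c _ ↦ Finset.mem_range.2 c.val_lt) (fun x hx ↦ ?_) (by simp) (fun x hx ↦ ?_) <;>
  simp [ZMod.val_cast_of_lt (Finset.mem_range.1 hx)]

theorem LFunction_one_eq_sum_cot {q : ℕ} [NeZero q] {Φ : ZMod q → ℂ} (hΦ : Φ.Odd) :
    ZMod.LFunction Φ 1 = π / (2 * q) * ∑ c, Φ c * cot (π * (c.val / q)) := by
  rw [ZMod.LFunction_def_odd hΦ, cpow_neg_one, Finset.mul_sum, Finset.mul_sum]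
  refine Finset.sum_congr rfl fun c _ ↦ ?_
  rw [hurwitzZetaOdd_toAddCircle_one]
  ring

theorem sum_div_eq_of_odd {q : ℕ} [NeZero q] {Φ : ZMod q → ℂ} (hΦ : Φ.Odd) (k : ℕ) :
    ∑ c, Φ c / ((q * k + c.val : ℕ) : ℂ) = ∑ c, Φ c / q *
      ((1 / (k + (c.val / q : ℝ) : ℂ) - 1 / (k + 1 - (c.val / q : ℝ) : ℂ)) / 2) := by
  have hq : (q : ℂ) ≠ 0 := NeZero.ne _
  have h1 : ∑ c, Φ c / ((q * k + c.val : ℕ) : ℂ) = ∑ c, -Φ c / ((q * k + (-c).val : ℕ) : ℂ) :=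
    Fintype.sum_equiv (Equiv.neg _) _ _ fun c ↦ by simp [hΦ c]
  have h2 : ∑ c, Φ c / ((q * k + c.val : ℕ) : ℂ) = (∑ c, Φ c / ((q * k + c.val : ℕ) : ℂ) +
      ∑ c, -Φ c / ((q * k + (-c).val : ℕ) : ℂ)) / 2 := by
    rw [← h1]; ring
  rw [h2, ← Finset.sum_add_distrib, Finset.sum_div]
  refine Finset.sum_congr rfl fun c _ ↦ ?_
  rcases eq_or_ne c 0 with rfl | hc
  · simp [hΦ.map_zero]
  have : NeZero c := ⟨hc⟩
  have e1 : ((q * k + c.val : ℕ) : ℂ) = q * (k + (c.val / q : ℝ)) := by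
    push_cast; field_simp
  have e2 : ((q * k + (-c).val : ℕ) : ℂ) = q * (k + 1 - (c.val / q : ℝ)) := by
    rw [ZMod.val_neg_of_ne_zero]
    push_cast [Nat.cast_sub c.val_lt.le]; field_simp; ring
  rw [e1, e2, ← div_div, ← div_div]
  ring

theorem tendsto_sum_range_mul_LFunction_one {q : ℕ} [NeZero q] {Φ : ZMod q → ℂ} (hΦ : Φ.Odd) :
    Filter.Tendsto (fun K : ℕ ↦ ∑ n ∈ Finset.range (q * K), Φ n / n) Filter.atTop
      (nhds (ZMod.LFunction Φ 1)) := by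
  have hq : (0 : ℝ) < q := Nat.cast_pos.2 (NeZero.pos q)
  have hblock (K : ℕ) : ∑ n ∈ Finset.range (q * K), Φ n / n =
      ∑ k ∈ Finset.range K, ∑ c, Φ c / ((q * k + c.val : ℕ) : ℂ) := by
    induction K with
    | zero => simp
    | succ K ih =>
      rw [mul_add_one, Finset.sum_range_add, ih, Finset.sum_range_succ, ZMod.sum_range_eq_sum_val q]
      simp
  simp only [hblock, sum_div_eq_of_odd hΦ]
  rw [ZMod.LFunction_def_odd hΦ, cpow_neg_one, Finset.mul_sum]
  refine HasSum.tendsto_sum_nat (hasSum_sum fun c _ ↦ ?_)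
  rw [← mul_assoc, ← div_eq_inv_mul]
  rcases eq_or_ne c 0 with rfl | hc
  · simp [hΦ.map_zero]
  refine HasSum.mul_left _ ?_
  have hv : 0 < c.val := ZMod.val_pos.2 hc
  rw [ZMod.toAddCircle_apply]
  refine hasSum_hurwitzZetaOdd_one ⟨by positivity, ?_⟩
  rw [div_lt_one hq]; exact_mod_cast c.val_lt

/-- The Dirichlet series of an odd periodic function converges at `1` to its `L`-value. -/
theorem tendsto_sum_range_LFunction_one {q : ℕ} [NeZero q] {Φ : ZMod q → ℂ} (hΦ : Φ.Odd) :
    Filter.Tendsto (fun N : ℕ ↦ ∑ n ∈ Finset.range N, Φ n / n) Filter.atTop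
      (nhds (ZMod.LFunction Φ 1)) := by
  have hq : 0 < q := NeZero.pos q
  have hdiv : Filter.Tendsto (fun N : ℕ ↦ N / q) Filter.atTop Filter.atTop :=
    Nat.tendsto_div_const_atTop hq.ne'
  have h1 := (tendsto_sum_range_mul_LFunction_one hΦ).comp hdiv
  have h2 : Filter.Tendsto (fun N : ℕ ↦ ∑ n ∈ Finset.range (N % q),
      Φ (q * (N / q) + n : ℕ) / (q * (N / q) + n : ℕ)) Filter.atTop (nhds 0) := by
    set M : ℝ := ∑ c, ‖Φ c‖
    have hM (c : ZMod q) : ‖Φ c‖ ≤ M :=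
      Finset.single_le_sum (f := fun c ↦ ‖Φ c‖) (fun _ _ ↦ norm_nonneg _) (Finset.mem_univ c)
    have hlim : Filter.Tendsto (fun N : ℕ ↦ q * M * ((N / q : ℕ) : ℝ)⁻¹) Filter.atTop (nhds 0) := by
      simpa using (tendsto_inv_atTop_zero.comp
        (tendsto_natCast_atTop_atTop.comp hdiv)).const_mul ((q : ℝ) * M)
    refine squeeze_zero_norm' ?_ hlim
    filter_upwards [hdiv.eventually_gt_atTop 0] with N hN
    have hb : ∀ n ∈ Finset.range (N % q),
        ‖Φ (q * (N / q) + n : ℕ) / (q * (N / q) + n : ℕ)‖ ≤ M * ((N / q : ℕ) : ℝ)⁻¹ := by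
      intro n _
      rw [norm_div, Complex.norm_natCast, div_eq_mul_inv]
      have h0 : (0 : ℝ) < (N / q : ℕ) := Nat.cast_pos.2 hN
      have : N / q ≤ q * (N / q) + n := by nlinarith
      have : ((N / q : ℕ) : ℝ) ≤ (q * (N / q) + n : ℕ) := Nat.cast_le.2 this
      exact mul_le_mul (hM _) (inv_anti₀ h0 this) (by positivity) ((norm_nonneg _).trans (hM 0))
    refine (norm_sum_le_of_le _ hb).trans ?_
    rw [Finset.sum_const, Finset.card_range, nsmul_eq_mul, ← mul_assoc]
    have hM0 : 0 ≤ M := (norm_nonneg _).trans (hM 0)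
    have : ((N % q : ℕ) : ℝ) ≤ q := Nat.cast_le.2 (Nat.mod_lt _ hq).le
    gcongr
  have h3 := h1.add h2
  rw [add_zero] at h3
  refine h3.congr fun N ↦ ?_
  conv_rhs => rw [← Nat.div_add_mod N q, Finset.sum_range_add]
  rfl

/-- The sawtooth function `c ↦ ψ(c/q)` on residue classes. -/
noncomputable def zmodSaw {q : ℕ} (c : ZMod q) : ℂ := saw (c.val / q)

/-- The function `c ↦ cot(πc/q)` on residue classes. -/
noncomputable def zmodCot {q : ℕ} (c : ZMod q) : ℂ := cot (π * (c.val / q))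

theorem saw_intCast_div {q : ℕ} [NeZero q] (m : ℤ) :
    (saw ((m : ℝ) / q) : ℂ) = zmodSaw (m : ZMod q) := by
  have h : Int.fract ((m : ℝ) / q) = Int.fract (((m : ZMod q).val : ℝ) / q) := by
    rw [Int.fract_eq_fract]
    refine ⟨m / q, ?_⟩
    have hq : (q : ℝ) ≠ 0 := NeZero.ne _
    have h1 : (((m : ZMod q).val : ℤ) : ℝ) = ((m % q : ℤ) : ℝ) := by rw [ZMod.val_intCast]
    have h2 : (m : ℝ) = ((m % q : ℤ) : ℝ) + q * ((m / q : ℤ) : ℝ) := by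
      exact_mod_cast (Int.emod_add_mul_ediv m q).symm
    rw [Int.cast_natCast] at h1
    rw [h1]
    nth_rw 1 [h2]
    field_simp
    ring
  simp only [zmodSaw, saw, h]

@[simp] theorem zmodSaw_zero {q : ℕ} : zmodSaw (0 : ZMod q) = 0 := by simp [zmodSaw, saw]

@[simp] theorem zmodCot_zero {q : ℕ} : zmodCot (0 : ZMod q) = 0 := by simp [zmodCot, cot]

theorem zmodSaw_of_ne_zero {q : ℕ} [NeZero q] {c : ZMod q} (hc : c ≠ 0) :
    zmodSaw c = c.val / q - 1 / 2 := by
  have hq : (0 : ℝ) < q := Nat.cast_pos.2 (NeZero.pos q)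
  have hv : (0 : ℝ) < c.val := Nat.cast_pos.2 (ZMod.val_pos.2 hc)
  have h : Int.fract ((c.val : ℝ) / q) = c.val / q := by
    rw [Int.fract_eq_self, div_lt_one hq]
    exact ⟨by positivity, Nat.cast_lt.2 c.val_lt⟩
  rw [zmodSaw, saw, h, if_neg (by positivity)]
  push_cast
  rfl

theorem zmodSaw_odd {q : ℕ} [NeZero q] : (zmodSaw (q := q)).Odd := by
  intro c
  rcases eq_or_ne c 0 with rfl | hc
  · simp
  have : NeZero c := ⟨hc⟩
  have hq : (q : ℂ) ≠ 0 := NeZero.ne _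
  rw [zmodSaw_of_ne_zero hc, zmodSaw_of_ne_zero (neg_ne_zero.2 hc), ZMod.val_neg_of_ne_zero,
    Nat.cast_sub c.val_lt.le]
  field_simp
  ring

theorem sum_range_mul_pow_mul_sq (e : ℂ) (n : ℕ) :
    (∑ j ∈ Finset.range n, e ^ j * j) * (e - 1) ^ 2 = n * e ^ n * (e - 1) - e * (e ^ n - 1) := by
  induction n with
  | zero => simp
  | succ n ih => rw [Finset.sum_range_succ, add_mul, ih]; push_cast; ring

open ZMod in
/-- The discrete Fourier transform of the sawtooth function. -/
theorem dft_zmodSaw {q : ℕ} [NeZero q] (m : ZMod q) : 𝓕 zmodSaw m = I / 2 * zmodCot m := by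
  rcases eq_or_ne m 0 with rfl | hm
  · rw [dft_apply_zero, zmodCot_zero, mul_zero, ← CharZero.eq_neg_self_iff, ← Finset.sum_neg_distrib]
    exact Fintype.sum_equiv (Equiv.neg _) _ _ fun c ↦ by simp [zmodSaw_odd c]
  have hq : (q : ℂ) ≠ 0 := NeZero.ne _
  set e : ℂ := stdAddChar (-m) with he
  have hpow (n : ℕ) : e ^ n = stdAddChar (-((n : ZMod q) * m)) := by
    rw [he, ← AddChar.map_nsmul_eq_pow, nsmul_eq_mul, mul_neg]
  have he1 : e - 1 ≠ 0 := by
    rw [sub_ne_zero, he, ← AddChar.map_zero_eq_one (stdAddChar (N := q)), injective_stdAddChar.ne_iff]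
    exact neg_ne_zero.2 hm
  have heq : e ^ q = 1 := by simp [hpow]
  have hgeom : ∑ j ∈ Finset.range q, e ^ j = 0 := by
    have h := geom_sum_mul e q
    rw [heq, sub_self] at h
    exact (mul_eq_zero.1 h).resolve_right he1
  have hlin : ∑ j ∈ Finset.range q, e ^ j * j = q / (e - 1) := by
    have h := sum_range_mul_pow_mul_sq e q
    rw [heq] at h
    rw [eq_div_iff he1]
    refine mul_right_cancel₀ he1 ?_
    linear_combination h
  have hsum : 𝓕 zmodSaw m = 1 / (e - 1) + 1 / 2 := by
    have hterm (j : ZMod q) : stdAddChar (-(j * m)) • zmodSaw j =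
        e ^ j.val * j.val / q - e ^ j.val / 2 + if j = 0 then 1 / 2 else 0 := by
      rw [hpow, natCast_zmod_val, smul_eq_mul]
      split_ifs with hj
      · simp [hj]
      · rw [zmodSaw_of_ne_zero hj]; ring
    rw [dft_apply, Finset.sum_congr rfl fun j _ ↦ hterm j, Finset.sum_add_distrib,
      Finset.sum_sub_distrib, ← Finset.sum_div, ← Finset.sum_div,
      ← ZMod.sum_range_eq_sum_val q fun j ↦ e ^ j * j, ← ZMod.sum_range_eq_sum_val q fun j ↦ e ^ j,
      hgeom, hlin, Finset.sum_ite_eq' Finset.univ (0 : ZMod q)]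
    simp
    field_simp
  have hcot : zmodCot m = (e⁻¹ + 1) / (I * (1 - e⁻¹)) := by
    rw [zmodCot, cot_pi_eq_exp_ratio, he, AddChar.map_neg_eq_inv, inv_inv, stdAddChar_apply,
      toCircle_apply, mul_div_assoc]
  have he0 : e ≠ 0 := by rintro h; simp [h, NeZero.ne q] at heq
  have he2 : 1 - e⁻¹ ≠ 0 := by
    intro h; apply he1; field_simp at h; simpa using h
  rw [hsum, hcot]
  have : (1 - e⁻¹) = (e - 1) / e := by field_simp
  rw [this]
  field_simp
  ring

open ZMod in
theorem LFunction_zero_eq_sum_zmodSaw {q : ℕ} [NeZero q] {Φ : ZMod q → ℂ} (hΦ : Φ.Odd) :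
    ZMod.LFunction Φ 0 = -∑ c, Φ c * zmodSaw c := by
  have hq : (q : ℂ) ≠ 0 := NeZero.ne _
  have hpi : (π : ℂ) ≠ 0 := ofReal_ne_zero.2 Real.pi_ne_zero
  have hneg : ZMod.LFunction (𝓕 fun x ↦ Φ (-x)) 1 = -ZMod.LFunction (𝓕 Φ) 1 := by
    rw [dft_comp_neg]
    simp [ZMod.LFunction, dft_odd_iff.2 hΦ _]
  have h := LFunction_one_sub Φ (s := 1) (fun n hn ↦ ?_) (.inl hΦ.map_zero)
  · have hI : cexp (π * I * 1 / 2) = I := by rw [mul_one, mul_div_right_comm, exp_pi_div_two_mul_I]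
    have hI' : cexp (-π * I * 1 / 2) = -I := by
      rw [mul_one, mul_div_right_comm, exp_neg_pi_div_two_mul_I]
    have hpars : ∑ c, 𝓕 Φ c * 𝓕 zmodSaw c = -q * ∑ c, Φ c * zmodSaw c := by
      have h2 (j : ZMod q) : ∑ c, stdAddChar (-(j * c)) * 𝓕 zmodSaw c = -q * zmodSaw j := by
        have := congr_fun (dft_dft (zmodSaw (q := q))) j
        rw [dft_apply] at this
        simpa [mul_comm j, zmodSaw_odd j] using this
      simp_rw [dft_apply Φ, Finset.sum_mul]
      rw [Finset.sum_comm, Finset.mul_sum]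
      refine Finset.sum_congr rfl fun j _ ↦ ?_
      rw [mul_left_comm, ← h2, Finset.mul_sum]
      refine Finset.sum_congr rfl fun c _ ↦ ?_
      rw [smul_eq_mul]; ring
    have hcot : ∑ c, 𝓕 Φ c * cot (π * (c.val / q)) = -2 * I * ∑ c, 𝓕 Φ c * 𝓕 zmodSaw c := by
      rw [Finset.mul_sum]
      refine Finset.sum_congr rfl fun c _ ↦ ?_
      rw [dft_zmodSaw, ← zmodCot]
      linear_combination 𝓕 Φ c * zmodCot c * I_sq
    rw [sub_self, hneg, hI, hI', Gamma_one, LFunction_one_eq_sum_cot (dft_odd_iff.2 hΦ), hcot,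
      hpars, cpow_zero, cpow_neg_one] at h
    rw [h]
    field_simp
    linear_combination 2 * (∑ c, Φ c * zmodSaw c) * I_sq
  · have := congr_arg re hn
    simp at this
    have h0 : (0 : ℝ) ≤ n := n.cast_nonneg
    linarith

/-- The common value `∑ₓ ψ(x/q) cot(π t x̄/q)` to which both formulas reduce. -/
noncomputable def sawCotSum {q : ℕ} [NeZero q] (T : ZMod q) : ℂ :=
  ∑ x : ZMod q, zmodSaw x * zmodCot (T * x⁻¹)

theorem dedekindSum_eq_sum_zmodSaw {q : ℕ} [NeZero q] (a : ℤ) :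
    (dedekindSum q a : ℂ) = ∑ x : ZMod q, zmodSaw x * zmodSaw ((a : ZMod q) * x) := by
  rw [dedekindSum, ZMod.sum_range_eq_sum_val q]
  push_cast
  refine Finset.sum_congr rfl fun x _ ↦ ?_
  have h := saw_intCast_div (q := q) (a * x.val)
  push_cast [ZMod.natCast_zmod_val] at h
  rw [h]
  rfl

open ZMod in
theorem shat_eq_sawCotSum {q : ℕ} [Fact q.Prime] (t : ℤ) :
    shat q t = -(I / (2 * q)) * sawCotSum (t : ZMod q) := by
  have hexp (a : ZMod q) : cexp (2 * π * I * (a.val * t) / q) = stdAddChar (a * (t : ZMod q)) := by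
    have h := stdAddChar_coe (N := q) (a.val * t)
    push_cast [natCast_zmod_val] at h
    rw [h]
  have hinner (x : ZMod q) : zmodSaw x * ∑ a, zmodSaw (a * x) * stdAddChar (a * (t : ZMod q)) =
      zmodSaw x * (-(I / 2) * zmodCot ((t : ZMod q) * x⁻¹)) := by
    rcases eq_or_ne x 0 with rfl | hx
    · simp
    have hneg : 𝓕 zmodSaw (-((t : ZMod q) * x⁻¹)) = -(𝓕 zmodSaw ((t : ZMod q) * x⁻¹)) :=
      dft_odd_iff.2 zmodSaw_odd _
    rw [neg_mul, ← dft_zmodSaw, ← hneg, dft_apply]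
    congr 1
    refine Fintype.sum_equiv (Equiv.mulRight₀ x hx) _ _ fun a ↦ ?_
    rw [smul_eq_mul, mul_comm, Equiv.mulRight₀_apply]
    congr 2
    field_simp
  rw [shat, ZMod.sum_range_eq_sum_val q]
  simp only [dedekindSum_eq_sum_zmodSaw, hexp, Int.cast_natCast, natCast_zmod_val, Finset.sum_mul]
  rw [Finset.sum_comm, sawCotSum, Finset.mul_sum, Finset.mul_sum]
  refine Finset.sum_congr rfl fun x _ ↦ ?_
  simp only [mul_assoc]
  rw [← Finset.mul_sum, hinner]
  ring

theorem LFunction_one_eq_sawCotSum {q : ℕ} [Fact q.Prime] {T : ZMod q} (hT : T ≠ 0) :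
    ZMod.LFunction (fun c ↦ zmodSaw (T * c⁻¹)) 1 = π / (2 * q) * sawCotSum T := by
  have hinv : Function.Involutive fun c : ZMod q ↦ T * c⁻¹ := fun c ↦ by
    simp only [mul_inv, inv_inv]
    field_simp
  rw [LFunction_one_eq_sum_cot fun c ↦ by simp [inv_neg, zmodSaw_odd _], sawCotSum]
  congr 1
  refine Fintype.sum_equiv hinv.toPerm _ _ fun c ↦ ?_
  simp only [Function.Involutive.coe_toPerm]
  rw [show T * (T * c⁻¹)⁻¹ = c from hinv c, zmodCot]

theorem DirichletCharacter.LFunction_zero_mul_LFunction_one {q : ℕ} [Fact q.Prime]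
    (χ : DirichletCharacter ℂ q) :
    (if χ ≠ 1 then χ.LFunction 0 * χ.LFunction 1 else 0) =
      -(∑ a, χ a * zmodSaw a) * (π / (2 * q) * ∑ c, χ c * zmodCot c) := by
  rcases χ.even_or_odd with hχ | hχ
  · have h0 : ∑ a, χ a * zmodSaw a = 0 := by
      rw [← CharZero.eq_neg_self_iff, ← Finset.sum_neg_distrib]
      exact Fintype.sum_equiv (Equiv.neg _) _ _ fun c ↦ by simp [zmodSaw_odd c, hχ.eval_neg]
    have h1 : χ.LFunction 0 = 0 := by
      rw [DirichletCharacter.LFunction, ZMod.LFunction_apply_zero_of_even hχ.to_fun,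
        MulChar.map_zero]
      simp
    simp [h0, h1]
  · have h : χ ≠ 1 := by
      rintro rfl
      have : (1 : DirichletCharacter ℂ q) (-1) = 1 := MulChar.one_apply isUnit_one.neg
      rw [hχ] at this
      norm_num at this
    rw [if_pos h, DirichletCharacter.LFunction, DirichletCharacter.LFunction,
      LFunction_zero_eq_sum_zmodSaw hχ.to_fun, LFunction_one_eq_sum_cot hχ.to_fun]
    rfl

theorem Lsum_eq_sawCotSum {q : ℕ} [Fact q.Prime] {t : ℤ} (ht : (t : ZMod q) ≠ 0) :
    Lsum q t = -(π / (2 * q)) * q.totient * sawCotSum (t : ZMod q) := by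
  have hq : q ≠ 0 := NeZero.ne q
  have hterm (χ : DirichletCharacter ℂ q) :
      (if χ ≠ 1 then (starRingEnd ℂ) (χ (t : ZMod q)) * χ.LFunction 0 * χ.LFunction 1 else 0) =
      ∑ a, ∑ c, -(π / (2 * q)) * (zmodSaw a * zmodCot c) *
        (χ (t : ZMod q)⁻¹ * χ (a * c)) := by
    have h : (if χ ≠ 1 then (starRingEnd ℂ) (χ (t : ZMod q)) * χ.LFunction 0 * χ.LFunction 1
        else 0) = χ (t : ZMod q)⁻¹ *
          (if χ ≠ 1 then χ.LFunction 0 * χ.LFunction 1 else 0) := by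
      rw [← MulChar.inv_apply', ← MulChar.star_apply']
      split_ifs
      · rw [mul_assoc, starRingEnd_apply]
      · rw [mul_zero]
    rw [h, DirichletCharacter.LFunction_zero_mul_LFunction_one, neg_mul, mul_left_comm,
      Finset.sum_mul_sum, Finset.mul_sum, ← Finset.sum_neg_distrib, Finset.mul_sum]
    refine Finset.sum_congr rfl fun a _ ↦ ?_
    rw [Finset.mul_sum, ← Finset.sum_neg_distrib, Finset.mul_sum]
    refine Finset.sum_congr rfl fun c _ ↦ ?_
    rw [map_mul]
    ring
  rw [Lsum, dif_neg hq, Finset.sum_filter, Finset.sum_congr rfl fun χ _ ↦ hterm χ,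
    Finset.sum_comm, sawCotSum, Finset.mul_sum]
  refine Finset.sum_congr rfl fun a _ ↦ ?_
  rw [Finset.sum_comm]
  simp only [← Finset.mul_sum, DirichletCharacter.sum_char_inv_mul_char_eq ℂ ht.isUnit]
  rcases eq_or_ne a 0 with rfl | ha
  · simp
  rw [Finset.sum_eq_single ((t : ZMod q) * a⁻¹)]
  · rw [if_pos (by field_simp)]
    ring
  · intro c _ hc
    rw [if_neg, mul_zero]
    rintro h
    exact hc (by rw [h]; field_simp)
  · simp

/-- Two formulas for `ŝ_q(t)` (Lemma 2.1). -/
theorem dedekind_fourier_formulas (q : ℕ) (hq : q.Prime) (t : ℤ) (ht : Int.gcd t q = 1) :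
    shat q t = -(1 / ((Real.pi : ℂ) * Complex.I * q.totient)) * Lsum q t ∧
    ∃ S : ℝ,
      Filter.Tendsto (fun N : ℕ => ∑ n ∈ Finset.Icc 1 N,
          if Nat.Coprime n q then saw (((t * invMod q n : ℤ) : ℝ) / q) / n else 0)
        Filter.atTop (nhds S) ∧
      shat q t = (1 / ((Real.pi : ℂ) * Complex.I)) * S := by
  have : Fact q.Prime := ⟨hq⟩
  have hpi : (π : ℂ) ≠ 0 := ofReal_ne_zero.2 Real.pi_ne_zero
  have hq0 : (q : ℂ) ≠ 0 := NeZero.ne _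
  have hT : (t : ZMod q) ≠ 0 := by
    rw [Ne, ZMod.intCast_zmod_eq_zero_iff_dvd]
    intro h
    exact hq.one_lt.ne' (Nat.dvd_one.1 (ht ▸ Int.dvd_gcd h dvd_rfl))
  constructor
  · have hφ : (q.totient : ℂ) ≠ 0 := Nat.cast_ne_zero.2 (Nat.totient_pos.2 hq.pos).ne'
    rw [shat_eq_sawCotSum, Lsum_eq_sawCotSum hT]
    field_simp
    linear_combination -sawCotSum (t : ZMod q) * I_sq
  set Φ : ZMod q → ℂ := fun c ↦ zmodSaw ((t : ZMod q) * c⁻¹) with hΦ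
  have hodd : Φ.Odd := fun c ↦ by simp [hΦ, inv_neg, zmodSaw_odd _]
  have hsum (N : ℕ) : ((∑ n ∈ Finset.Icc 1 N,
      if Nat.Coprime n q then saw (((t * invMod q n : ℤ) : ℝ) / q) / n else 0 : ℝ) : ℂ) =
      ∑ n ∈ Finset.range (N + 1), Φ n / n := by
    rw [Finset.sum_range_succ', Finset.range_eq_Ico,
      Finset.sum_Ico_add' (fun n : ℕ ↦ Φ n / n) 0 N 1, ofReal_sum]
    have hIco : Finset.Ico (0 + 1) (N + 1) = Finset.Icc 1 N := rfl
    simp only [hIco, Nat.cast_zero, div_zero, add_zero]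
    refine Finset.sum_congr rfl fun n _ ↦ ?_
    split_ifs with hn
    · rw [ofReal_div, saw_intCast_div]
      simp [hΦ, invMod]
    · have : (n : ZMod q) = 0 := by
        rw [ZMod.natCast_eq_zero_iff]
        rwa [Nat.coprime_comm, hq.coprime_iff_not_dvd, not_not] at hn
      simp [hΦ, this]
  have hlim := (Filter.tendsto_add_atTop_iff_nat 1).2 (tendsto_sum_range_LFunction_one hodd)
  simp only [← hsum] at hlim
  have hre := (continuous_re.tendsto _).comp hlim
  simp only [Function.comp_def, ofReal_re] at hre
  refine ⟨_, hre, ?_⟩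
  rw [← tendsto_nhds_unique hlim ((continuous_ofReal.tendsto _).comp hre),
    LFunction_one_eq_sawCotSum hT, shat_eq_sawCotSum]
  field_simp
  linear_combination -sawCotSum (t : ZMod q) * I_sq
end

section
/- For every ε > 0 there is a constant A_ε such that for every odd prime q, every integer k, and every natural number N, one has |C(k) + C Σ_{n ≤ N, gcd(n,q)=1} b(n) ψ(k·m(n)/q)| ≤ A_ε · q^{3/2+ε} N^{−1/4+ε}, where m(n) denotes the multiplicative inverse of 2n mod q. -/
open scoped Classical Real
open Complex MeasureTheory

/-- The Euler product `A_{q,χ}`. -/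
noncomputable def Aq (q : ℕ) (χ : DirichletCharacter ℂ q) : ℂ :=
  ∏' p : Nat.Primes, if (p : ℕ) ∣ q then 1 else
    1 - (1 - χ ((p : ℕ) : ZMod q)) ^ 2 / (((p : ℕ) : ℂ) - 1) ^ 2

/-- The quantity `C(k) = C(k; q)` (a real number; we take the real part of the
defining expression, which is real). -/
noncomputable def Cfun (q : ℕ) (k : ℤ) : ℝ :=
  if h : q = 0 then 0 else
    haveI : NeZero q := ⟨h⟩
    ((↑q.totient : ℂ)⁻¹ *
      ∑ χ ∈ Finset.univ.filter (fun χ : DirichletCharacter ℂ q => χ ≠ 1),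
        (starRingEnd ℂ) (χ ((k : ZMod q))) * DirichletCharacter.LFunction χ 0 *
          DirichletCharacter.LFunction χ 1 * Aq q χ).re

/-- The multiplicative function `a(n)`: `a(2) = -1/2`, `a(2^v) = 0` for `v ≥ 2`, and for odd
primes `p`, `a(p) = 2/(p(p-2))`, `a(p²) = -1/(p(p-2))`, `a(p^v) = 0` for `v ≥ 3`. -/
noncomputable def aCoef (n : ℕ) : ℝ :=
  if n = 0 then 0 else
    ∏ p ∈ n.primeFactors,
      if p = 2 then (if n.factorization 2 = 1 then (-1/2 : ℝ) else 0)
      else (if n.factorization p = 1 then 2 / (p * (p - 2) : ℝ)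
            else if n.factorization p = 2 then -1 / (p * (p - 2) : ℝ) else 0)

/-- `b(n) = ∑_{uv = n} a(u)/v`. -/
noncomputable def bCoef (n : ℕ) : ℝ := ∑ u ∈ n.divisors, aCoef u / ((n / u : ℕ) : ℝ)

/-- The constant `C = C_q = 2 ∏_{p odd prime, p ∤ q} (1 - 1/(p-1)²)`. -/
noncomputable def Cq (q : ℕ) : ℝ :=
  2 * ∏' p : Nat.Primes, if (p : ℕ) = 2 ∨ (p : ℕ) ∣ q then 1
    else 1 - 1 / ((p : ℝ) - 1) ^ 2

theorem norm_sum_Ico_mul_le {f : ℕ → ℂ} {B : ℝ} (hB : ∀ m, ‖∑ i ∈ Finset.range m, f i‖ ≤ B)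
    {w : ℕ → ℝ} {m : ℕ} (hw : ∀ i, m ≤ i → w (i + 1) ≤ w i) (hw₀ : ∀ i, 0 ≤ w i)
    {n : ℕ} (hmn : m ≤ n) :
    ‖∑ i ∈ Finset.Ico m n, f i * w i‖ ≤ 2 * B * w m := by
  have key : ‖∑ i ∈ Finset.Ico m n, f i * w i - (∑ i ∈ Finset.range n, f i) * w n +
      (∑ i ∈ Finset.range m, f i) * w m‖ ≤ B * (w m - w n) := by
    induction n, hmn using Nat.le_induction with
    | base => simp
    | succ n hn ih =>
      have e : ∑ i ∈ Finset.Ico m (n + 1), f i * w i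
            - (∑ i ∈ Finset.range (n + 1), f i) * w (n + 1)
            + (∑ i ∈ Finset.range m, f i) * w m =
          (∑ i ∈ Finset.Ico m n, f i * w i - (∑ i ∈ Finset.range n, f i) * w n +
            (∑ i ∈ Finset.range m, f i) * w m) +
          (∑ i ∈ Finset.range (n + 1), f i) * ((w n - w (n + 1) : ℝ) : ℂ) := by
        rw [Finset.sum_Ico_succ_top hn, Finset.sum_range_succ]
        push_cast
        ring
      have h2 : ‖(∑ i ∈ Finset.range (n + 1), f i) * ((w n - w (n + 1) : ℝ) : ℂ)‖
          ≤ B * (w n - w (n + 1)) := by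
        rw [norm_mul, Complex.norm_of_nonneg (sub_nonneg.2 (hw n hn))]
        exact mul_le_mul_of_nonneg_right (hB _) (sub_nonneg.2 (hw n hn))
      rw [e]
      refine (norm_add_le _ _).trans ?_
      linarith
  have h (j : ℕ) : ‖(∑ i ∈ Finset.range j, f i) * (w j : ℂ)‖ ≤ B * w j := by
    rw [norm_mul, Complex.norm_of_nonneg (hw₀ j)]
    exact mul_le_mul_of_nonneg_right (hB _) (hw₀ j)
  have e : ∑ i ∈ Finset.Ico m n, f i * w i =
      (∑ i ∈ Finset.Ico m n, f i * w i - (∑ i ∈ Finset.range n, f i) * w n +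
        (∑ i ∈ Finset.range m, f i) * w m) + (∑ i ∈ Finset.range n, f i) * w n
        - (∑ i ∈ Finset.range m, f i) * w m := by ring
  rw [e]
  refine (norm_sub_le _ _).trans ((add_le_add (norm_add_le _ _) le_rfl).trans ?_)
  linarith [h n, h m]

open Filter Topology in
/-- If the partial sums of `f` are bounded by `B`, the Dirichlet series of `f` converges at `1`
to the continuous extension of its sum, with an explicit tail bound. -/
theorem norm_sub_sum_div_le {f : ℕ → ℂ} {B : ℝ}
    (hB : ∀ m, ‖∑ i ∈ Finset.range m, f i‖ ≤ B) {F : ℂ → ℂ} (hF : ContinuousAt F 1)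
    (hs : ∀ s : ℝ, 1 < s → HasSum (fun n : ℕ => f n / (n : ℂ) ^ (s : ℂ)) (F s))
    {m : ℕ} (hm : 0 < m) :
    ‖F 1 - ∑ i ∈ Finset.range m, f i / i‖ ≤ 2 * B / m := by
  have h1 (s : ℝ) (h : 1 < s) :
      ‖F s - ∑ i ∈ Finset.range m, f i / (i : ℂ) ^ (s : ℂ)‖ ≤ 2 * B * (m : ℝ) ^ (-s) := by
    have lim := ((hs s h).tendsto_sum_nat.sub_const
      (∑ i ∈ Finset.range m, f i / (i : ℂ) ^ (s : ℂ))).norm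
    refine le_of_tendsto lim ?_
    filter_upwards [eventually_ge_atTop m] with n hn
    rw [← Finset.sum_Ico_eq_sub _ hn]
    have := norm_sum_Ico_mul_le hB (w := fun i : ℕ => (i : ℝ) ^ (-s)) (m := m) (n := n)
      (fun i hi => Real.rpow_le_rpow_of_nonpos (by exact_mod_cast hm.trans_le hi)
        (by push_cast; linarith) (by linarith)) (fun i => by positivity) hn
    rwa [Finset.sum_congr rfl fun i _ => show f i / (i : ℂ) ^ (s : ℂ) =
      f i * (((i : ℝ) ^ (-s) : ℝ) : ℂ) by
        rw [Complex.ofReal_cpow (by positivity), div_eq_mul_inv, ← Complex.cpow_neg]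
        push_cast
        rfl]
  have c1 : Tendsto (fun s : ℝ => ((s : ℝ) : ℂ)) (𝓝[>] 1) (𝓝 1) := by
    have : Tendsto (fun s : ℝ => ((s : ℝ) : ℂ)) (𝓝 1) (𝓝 ((1 : ℝ) : ℂ)) :=
      Complex.continuous_ofReal.tendsto 1
    simpa using this.mono_left nhdsWithin_le_nhds
  have c2 : Tendsto (fun s : ℝ => ∑ i ∈ Finset.range m, f i / (i : ℂ) ^ (s : ℂ)) (𝓝[>] 1)
      (𝓝 (∑ i ∈ Finset.range m, f i / (i : ℂ))) := by
    refine tendsto_finsetSum _ fun i _ => ?_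
    rcases eq_or_ne i 0 with rfl | hi
    · refine (tendsto_congr' ?_).2 tendsto_const_nhds
      filter_upwards [self_mem_nhdsWithin] with s hs
      have : (s : ℂ) ≠ 0 := by
        have : (0 : ℝ) < s := lt_trans one_pos hs
        exact_mod_cast this.ne'
      simp [Complex.zero_cpow this]
    · have hi' : (i : ℂ) ≠ 0 := by exact_mod_cast hi
      have := (continuousAt_const_cpow (b := 1) hi').tendsto.comp c1
      rw [Complex.cpow_one] at this
      exact tendsto_const_nhds.div this hi'
  have c3 : Tendsto (fun s : ℝ => 2 * B * (m : ℝ) ^ (-s)) (𝓝[>] 1) (𝓝 (2 * B / m)) := by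
    have hm' : (m : ℝ) ≠ 0 := by exact_mod_cast hm.ne'
    have : ContinuousAt (fun s : ℝ => 2 * B * (m : ℝ) ^ (-s)) 1 :=
      continuousAt_const.mul (continuousAt_const.rpow continuousAt_neg (Or.inl hm'))
    have h := this.tendsto.mono_left (nhdsWithin_le_nhds (s := Set.Ioi 1))
    rwa [Real.rpow_neg_one, ← div_eq_mul_inv] at h
  refine le_of_tendsto_of_tendsto ((hF.tendsto.comp c1).sub c2).norm c3 ?_
  filter_upwards [self_mem_nhdsWithin] with s hs using h1 s hs

theorem unitAddCircle_coe_ne_zero {x : ℝ} (hx : x ∈ Set.Ioo (0 : ℝ) 1) :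
    (x : UnitAddCircle) ≠ 0 := by
  intro h
  obtain ⟨n, hn⟩ := (AddCircle.coe_eq_zero_iff (1 : ℝ)).1 h
  have hn' : (n : ℝ) = x := by simpa using hn
  have h0 : (0 : ℝ) < n := hn' ▸ hx.1
  have h1 : (n : ℝ) < 1 := hn' ▸ hx.2
  norm_cast at h0 h1
  omega

open Filter Topology in
theorem expZeta_one {x : ℝ} (hx : x ∈ Set.Ioo (0 : ℝ) 1) :
    HurwitzZeta.expZeta x 1 = -Complex.log (1 - cexp (2 * π * I * x)) := by
  set z := cexp (2 * π * I * x) with hz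
  have hz' : z = cexp ((2 * π * x : ℝ) * I) := by rw [hz]; push_cast; ring_nf
  have hnorm : ‖z‖ = 1 := by rw [hz', Complex.norm_exp_ofReal_mul_I]
  have hre : z.re < 1 := by
    rw [hz', Complex.exp_ofReal_mul_I_re]
    refine lt_of_le_of_ne (Real.cos_le_one _) fun h => ?_
    obtain ⟨n, hn⟩ := (Real.cos_eq_one_iff _).1 h
    have hn' : (n : ℝ) = x := by
      have := Real.pi_pos
      have h2 : 2 * π * ((n : ℝ) - x) = 0 := by linarith
      have : (2 * π : ℝ) ≠ 0 := by positivity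
      linarith [(mul_eq_zero.1 h2).resolve_left this]
    have h0 : (0 : ℝ) < n := hn' ▸ hx.1
    have h1 : (n : ℝ) < 1 := hn' ▸ hx.2
    norm_cast at h0 h1
    omega
  have hz1 : z ≠ 1 := fun h => by simp [h] at hre
  have ha := unitAddCircle_coe_ne_zero hx
  have hB (m : ℕ) : ‖∑ i ∈ Finset.range m, z ^ i‖ ≤ 2 / ‖z - 1‖ := by
    rw [geom_sum_eq hz1, norm_div]
    gcongr
    refine (norm_sub_le _ _).trans ?_
    rw [norm_pow, hnorm]
    norm_num
  have hlim : Tendsto (fun m => ∑ i ∈ Finset.range m, z ^ i / i) atTop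
      (𝓝 (HurwitzZeta.expZeta x 1)) := by
    rw [tendsto_iff_norm_sub_tendsto_zero]
    refine squeeze_zero' (Eventually.of_forall fun _ => norm_nonneg _) ?_
      (tendsto_const_div_atTop_nhds_zero_nat (2 * (2 / ‖z - 1‖)))
    filter_upwards [eventually_gt_atTop 0] with m hm
    rw [norm_sub_rev]
    refine norm_sub_sum_div_le hB
      (HurwitzZeta.differentiable_expZeta_of_ne_zero ha).continuous.continuousAt
      (fun s hs => ?_) hm
    have := HurwitzZeta.hasSum_expZeta_of_one_lt_re x (s := s) (by simpa using hs)
    convert this using 3 with n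
    rw [hz, ← Complex.exp_nat_mul]
    ring_nf
  have habel := Complex.tendsto_tsum_powerSeries_nhdsWithin_lt hlim
  have hc : Tendsto (fun r : ℂ => -Complex.log (1 - r * z)) (map ofReal (𝓝[<] 1))
      (𝓝 (-Complex.log (1 - z))) := by
    have h1 : ContinuousAt (fun r : ℂ => -Complex.log (1 - r * z)) 1 := by
      refine (ContinuousAt.clog (by fun_prop) ?_).neg
      exact Or.inl (by simpa using hre)
    have h2 := h1.tendsto
    rw [one_mul] at h2
    refine h2.comp (f := id) ?_
    have h3 : Tendsto ofReal (𝓝 1) (𝓝 ((1 : ℝ) : ℂ)) := Complex.continuous_ofReal.tendsto 1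
    rw [Complex.ofReal_one] at h3
    exact h3.mono_left nhdsWithin_le_nhds
  refine tendsto_nhds_unique (habel.congr' ?_) hc
  rw [EventuallyEq, eventually_map]
  filter_upwards [Ioo_mem_nhdsLT (show (0 : ℝ) < 1 by norm_num)] with r hr
  have hr1 : ‖(r : ℂ) * z‖ < 1 := by
    rw [norm_mul, hnorm, mul_one, Complex.norm_of_nonneg hr.1.le]
    exact hr.2
  rw [← (Complex.hasSum_taylorSeries_neg_log hr1).tsum_eq]
  congr 1 with n
  rw [mul_pow]
  ring

theorem hurwitzZeta_apply_zero {x : ℝ} (hx : x ∈ Set.Ioo (0 : ℝ) 1) :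
    HurwitzZeta.hurwitzZeta x 0 = 1 / 2 - x := by
  have harg (y : ℝ) (hy : y ∈ Set.Ioo (0 : ℝ) 1) :
      (Complex.log (1 - cexp (2 * π * I * y))).im = π * (y - 1 / 2) := by
    have hsin : 0 < Real.sin (π * y) :=
      Real.sin_pos_of_pos_of_lt_pi (mul_pos Real.pi_pos hy.1)
        (by nlinarith [Real.pi_pos, hy.2])
    have e : 1 - cexp (2 * π * I * y) = ((2 * Real.sin (π * y) : ℝ) : ℂ) *
        (Complex.cos ((π * (y - 1 / 2) : ℝ) : ℂ) +
          Complex.sin ((π * (y - 1 / 2) : ℝ) : ℂ) * I) := by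
      have a1 : ((π * (y - 1 / 2) : ℝ) : ℂ) = π * y - π / 2 := by push_cast; ring
      rw [a1, Complex.cos_sub_pi_div_two, Complex.sin_sub_pi_div_two,
        show (2 * π * I * y : ℂ) = (2 * (π * y)) * I by ring, Complex.exp_mul_I,
        Complex.cos_two_mul, Complex.sin_two_mul]
      push_cast
      linear_combination (-2 : ℂ) * Complex.sin_sq_add_cos_sq (π * y)
    rw [Complex.log_im, e, Complex.arg_real_mul _ (by positivity)]
    refine Complex.arg_cos_add_sin_mul_I ⟨?_, ?_⟩ <;> nlinarith [Real.pi_pos, hy.1, hy.2]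
  have ha := unitAddCircle_coe_ne_zero hx
  have hneg : (-(x : UnitAddCircle)) = ((1 - x : ℝ) : UnitAddCircle) := by
    rw [AddCircle.coe_sub, AddCircle.coe_period, zero_sub]
  have hx' : 1 - x ∈ Set.Ioo (0 : ℝ) 1 := ⟨by linarith [hx.2], by linarith [hx.1]⟩
  have main := HurwitzZeta.hurwitzZeta_one_sub (x : UnitAddCircle) (s := 1)
    (fun n h => by
      have := congrArg Complex.re h
      simp at this
      linarith [(Nat.cast_nonneg n : (0 : ℝ) ≤ n)]) (Or.inl ha)
  rw [sub_self, hneg, expZeta_one hx, expZeta_one hx'] at main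
  have hconj : cexp (2 * π * I * (1 - x : ℝ)) =
      (starRingEnd ℂ) (cexp (2 * π * I * x)) := by
    rw [← Complex.exp_conj]
    simp only [map_mul, Complex.conj_I, Complex.conj_ofReal, map_ofNat]
    rw [show (2 * π * I * (1 - x : ℝ) : ℂ) = 2 * π * (-I) * x + 2 * π * I by push_cast; ring,
      Complex.exp_add, Complex.exp_two_pi_mul_I, mul_one]
  have hlog : Complex.log (1 - cexp (2 * π * I * (1 - x : ℝ))) =
      (starRingEnd ℂ) (Complex.log (1 - cexp (2 * π * I * x))) := by
    rw [← Complex.log_conj, map_sub, map_one, hconj]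
    rw [← Complex.log_im, harg x hx]
    intro h
    nlinarith [Real.pi_pos, hx.1, hx.2]
  rw [hlog] at main
  have him := harg x hx
  set w := Complex.log (1 - cexp (2 * π * I * x))
  have e1 : cexp (-π * I * 1 / 2) = -I := by
    rw [show (-π * I * 1 / 2 : ℂ) = -(π / 2 * I) by ring, Complex.exp_neg,
      Complex.exp_pi_div_two_mul_I, Complex.inv_I]
  have e2 : cexp (π * I * 1 / 2) = I := by
    rw [show (π * I * 1 / 2 : ℂ) = (π / 2 * I) by ring, Complex.exp_pi_div_two_mul_I]
  rw [e1, e2, Complex.Gamma_one, Complex.cpow_neg_one] at main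
  have hw : w - (starRingEnd ℂ) w = 2 * (π * (x - 1 / 2) : ℝ) * I := by
    rw [Complex.sub_conj, him]; push_cast; ring
  rw [main]
  have hpi : (π : ℂ) ≠ 0 := by exact_mod_cast Real.pi_ne_zero
  field_simp
  push_cast at hw
  linear_combination I * hw + (2 * π * (x - 1 / 2) : ℂ) * Complex.I_sq

/-- The sawtooth function on residues, `a ↦ ψ(a / q)`. -/
noncomputable def sawZMod (q : ℕ) (a : ZMod q) : ℝ := saw ((a.val : ℝ) / q)

theorem saw_int_div (q : ℕ) [NeZero q] (j : ℤ) : saw ((j : ℝ) / q) = sawZMod q (j : ZMod q) := by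
  have hq : (q : ℝ) ≠ 0 := by exact_mod_cast NeZero.ne q
  have h : (j : ℝ) / q = ((((j : ZMod q).val : ℕ) : ℝ) / q) + ((j / q : ℤ) : ℝ) := by
    have h1 : (((j : ZMod q).val : ℤ)) = j % q := ZMod.val_intCast j
    have h2 : (((j : ZMod q).val : ℕ) : ℝ) = ((j % q : ℤ) : ℝ) := by
      rw [← h1]; simp
    rw [h2, eq_comm, div_add' _ _ _ hq]
    congr 1
    have := Int.emod_add_mul_ediv j q
    have h3 : ((j % q + q * (j / q) : ℤ) : ℝ) = j := by rw [this]
    rw [← h3]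
    push_cast
    ring
  rw [sawZMod, saw, saw, h, Int.fract_add_intCast]

theorem sawZMod_of_ne_zero {q : ℕ} [NeZero q] {a : ZMod q} (ha : a ≠ 0) :
    sawZMod q a = a.val / q - 1 / 2 ∧ ((a.val : ℝ) / q) ∈ Set.Ioo (0 : ℝ) 1 := by
  have hq : (0 : ℝ) < q := by exact_mod_cast NeZero.pos q
  have h0 : (0 : ℝ) < a.val / q := by
    have : 0 < a.val := Nat.pos_of_ne_zero (by rwa [Ne, ZMod.val_eq_zero])
    positivity
  have h1 : (a.val : ℝ) / q < 1 := by
    rw [div_lt_one hq]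
    exact_mod_cast ZMod.val_lt a
  refine ⟨?_, h0, h1⟩
  rw [sawZMod, saw, Int.fract_eq_self.2 ⟨h0.le, h1⟩, if_neg h0.ne']

theorem sawZMod_zero (q : ℕ) : sawZMod q 0 = 0 := by simp [sawZMod, saw]

theorem sawZMod_neg {q : ℕ} [NeZero q] (a : ZMod q) : sawZMod q (-a) = -sawZMod q a := by
  rcases eq_or_ne a 0 with rfl | ha
  · simp [sawZMod_zero]
  · have hq : (q : ℝ) ≠ 0 := by exact_mod_cast NeZero.ne q
    rw [(sawZMod_of_ne_zero ha).1, (sawZMod_of_ne_zero (neg_ne_zero.2 ha)).1, ZMod.neg_val,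
      if_neg ha, Nat.cast_sub (ZMod.val_lt a).le]
    field_simp
    ring

theorem abs_sawZMod_le {q : ℕ} [NeZero q] (a : ZMod q) : |sawZMod q a| ≤ 1 := by
  rcases eq_or_ne a 0 with rfl | ha
  · simp [sawZMod_zero]
  · obtain ⟨h, h0, h1⟩ := sawZMod_of_ne_zero ha
    rw [h, abs_le]
    constructor <;> linarith

theorem sum_sawZMod (q : ℕ) [NeZero q] : ∑ a : ZMod q, sawZMod q a = 0 := by
  have h : ∑ a : ZMod q, sawZMod q a = ∑ a : ZMod q, sawZMod q (-a) :=
    Fintype.sum_equiv (Equiv.neg (ZMod q)) _ _ fun a => by simp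
  simp only [sawZMod_neg, Finset.sum_neg_distrib] at h
  linarith

theorem LFunction_zero_eq {q : ℕ} [NeZero q] (hq : q ≠ 1) (χ : DirichletCharacter ℂ q) :
    DirichletCharacter.LFunction χ 0 = -∑ a : ZMod q, χ a * sawZMod q a := by
  have : Nontrivial (ZMod q) := ZMod.nontrivial_iff.2 hq
  rw [DirichletCharacter.LFunction, ZMod.LFunction, neg_zero, Complex.cpow_zero, one_mul,
    ← Finset.sum_neg_distrib]
  refine Finset.sum_congr rfl fun a _ => ?_
  rcases eq_or_ne a 0 with rfl | ha
  · simp [sawZMod_zero, MulChar.map_zero χ]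
  · obtain ⟨h, hmem⟩ := sawZMod_of_ne_zero ha
    rw [ZMod.toAddCircle_apply, hurwitzZeta_apply_zero hmem, h]
    push_cast
    ring

theorem norm_LFunction_zero_le {q : ℕ} [NeZero q] (hq : q ≠ 1) (χ : DirichletCharacter ℂ q) : ‖DirichletCharacter.LFunction χ 0‖ ≤ q := by
  rw [LFunction_zero_eq hq χ, norm_neg]
  refine (norm_sum_le_of_le _ (n := fun _ => (1 : ℝ)) fun a _ => ?_).trans (by simp [ZMod.card])
  rw [norm_mul, Complex.norm_real, Real.norm_eq_abs]
  exact mul_le_one₀ (χ.norm_le_one a) (abs_nonneg _) (abs_sawZMod_le a)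

theorem norm_sum_range_character_le {q : ℕ} [NeZero q] {χ : DirichletCharacter ℂ q}
    (hχ : χ ≠ 1) (m : ℕ) : ‖∑ i ∈ Finset.range m, χ (i : ZMod q)‖ ≤ q := by
  have hblock : ∑ i ∈ Finset.range q, χ (i : ZMod q) = 0 := by
    rw [← MulChar.sum_eq_zero_of_ne_one hχ]
    refine Finset.sum_bij' (fun i _ => (i : ZMod q)) (fun a _ => a.val) ?_ ?_ ?_ ?_ ?_
    · simp
    · simp [ZMod.val_lt]
    · intro i hi
      exact ZMod.val_cast_of_lt (Finset.mem_range.1 hi)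
    · simp
    · simp
  induction m using Nat.strong_induction_on with
  | _ m ih =>
    rcases le_or_gt m q with h | h
    · refine (norm_sum_le_of_le _ (n := fun _ => (1 : ℝ)) fun a _ => χ.norm_le_one _).trans ?_
      simpa using h
    · obtain ⟨k, rfl⟩ := Nat.exists_eq_add_of_lt h
      rw [add_assoc, Finset.sum_range_add, hblock, zero_add]
      simp only [Nat.cast_add, CharP.cast_eq_zero, zero_add]
      have := NeZero.pos q
      simpa using ih (k + 1) (by omega)

theorem norm_LFunction_one_sub_le {q : ℕ} [NeZero q] {χ : DirichletCharacter ℂ q}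
    (hχ : χ ≠ 1) {m : ℕ} (hm : 0 < m) :
    ‖DirichletCharacter.LFunction χ 1 - ∑ i ∈ Finset.range m, χ (i : ZMod q) / i‖
      ≤ 2 * q / m := by
  refine norm_sub_sum_div_le (norm_sum_range_character_le hχ)
    (DirichletCharacter.differentiable_LFunction hχ).continuous.continuousAt (fun s hs => ?_) hm
  have hs' : 1 < (s : ℂ).re := by simpa using hs
  rw [DirichletCharacter.LFunction_eq_LSeries χ hs']
  have h : HasSum (LSeries.term (fun n : ℕ => χ (n : ZMod q)) s) _ :=
    (ZMod.LSeriesSummable_of_one_lt_re χ hs').LSeriesHasSum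
  refine h.congr_fun fun n => ?_
  rcases eq_or_ne n 0 with rfl | hn
  · have : (s : ℂ) ≠ 0 := by exact_mod_cast (one_pos.trans hs).ne'
    simp [Complex.zero_cpow this]
  · rw [LSeries.term_of_ne_zero hn]

theorem norm_LFunction_one_sub_le_rpow {q : ℕ} [NeZero q] {χ : DirichletCharacter ℂ q}
    (hχ : χ ≠ 1) {m : ℕ} (hm : 0 < m) :
    ‖DirichletCharacter.LFunction χ 1 - ∑ i ∈ Finset.range m, χ (i : ZMod q) / i‖
      ≤ 8 * (q : ℝ) ^ (1 / 2 : ℝ) * (m : ℝ) ^ (-(1 / 4) : ℝ) := by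
  have hq : 0 < q := NeZero.pos q
  have hq1 : (1 : ℝ) ≤ q := by exact_mod_cast hq
  have hq0 : (0 : ℝ) < q := by positivity
  have hm0 : (0 : ℝ) < m := by exact_mod_cast hm
  have hsplit : (q : ℝ) ^ (1 / 2 : ℝ) = (q : ℝ) ^ (1 / 4 : ℝ) * (q : ℝ) ^ (1 / 4 : ℝ) := by
    rw [← Real.rpow_add hq0]; norm_num
  have hq4 : (1 : ℝ) ≤ (q : ℝ) ^ (1 / 4 : ℝ) := Real.one_le_rpow hq1 (by norm_num)
  rcases le_or_gt q m with h | h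
  · refine (norm_LFunction_one_sub_le hχ hm).trans ?_
    have h1 : (q : ℝ) / m ≤ ((q : ℝ) / m) ^ (1 / 4 : ℝ) := by
      have := Real.rpow_le_rpow_of_exponent_ge (x := (q : ℝ) / m) (by positivity)
        ((div_le_one hm0).2 (by exact_mod_cast h)) (show (1 / 4 : ℝ) ≤ 1 by norm_num)
      rwa [Real.rpow_one] at this
    rw [Real.div_rpow hq0.le hm0.le, div_eq_mul_inv _ ((m : ℝ) ^ (1 / 4 : ℝ)),
      ← Real.rpow_neg hm0.le] at h1
    have h2 : (0 : ℝ) ≤ (q : ℝ) ^ (1 / 4 : ℝ) * (m : ℝ) ^ (-(1 / 4) : ℝ) := by positivity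
    rw [hsplit, mul_div_assoc]
    nlinarith
  · have h1 := norm_LFunction_one_sub_le hχ hq
    rw [mul_div_assoc, div_self hq0.ne', mul_one] at h1
    have h2 : ‖∑ i ∈ Finset.Ico m q, χ (i : ZMod q) / i‖ ≤ 1 + Real.log q := by
      refine (norm_sum_le_of_le _ (n := fun i : ℕ => ((i : ℝ))⁻¹) fun i _ => ?_).trans ?_
      · rw [norm_div, Complex.norm_natCast, div_eq_mul_inv]
        exact mul_le_of_le_one_left (by positivity) (χ.norm_le_one _)
      · refine le_trans ?_ (harmonic_le_one_add_log q)
        rw [harmonic_eq_sum_Icc]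
        push_cast
        refine Finset.sum_le_sum_of_subset_of_nonneg (fun i hi => ?_) fun i _ _ => by positivity
        simp only [Finset.mem_Ico, Finset.mem_Icc] at hi ⊢
        omega
    have h3 : Real.log q ≤ (q : ℝ) ^ (1 / 4 : ℝ) / (1 / 4) :=
      Real.log_le_rpow_div hq0.le (by norm_num)
    have h4 : (1 : ℝ) ≤ (q : ℝ) ^ (1 / 4 : ℝ) * (m : ℝ) ^ (-(1 / 4) : ℝ) := by
      rw [Real.rpow_neg hm0.le, ← div_eq_mul_inv, one_le_div (by positivity)]
      exact Real.rpow_le_rpow hm0.le (by exact_mod_cast h.le) (by norm_num)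
    have e : DirichletCharacter.LFunction χ 1 - ∑ i ∈ Finset.range m, χ (i : ZMod q) / i =
        (DirichletCharacter.LFunction χ 1 - ∑ i ∈ Finset.range q, χ (i : ZMod q) / i) +
        ∑ i ∈ Finset.Ico m q, χ (i : ZMod q) / i := by
      rw [Finset.sum_Ico_eq_sub _ h.le]; ring
    rw [e]
    refine (norm_add_le _ _).trans ?_
    rw [hsplit]
    nlinarith

/-- A nonnegative multiplicative function is summable when its local sums at the primes are
dominated by `1 + t p` with `t` summable. -/
theorem summable_of_multiplicative {f : ℕ → ℝ} (hf : ∀ n, 0 ≤ f n) (hf₀ : f 0 = 0) (hf₁ : f 1 = 1)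
    (hmul : ∀ {m n : ℕ}, m.Coprime n → f (m * n) = f m * f n)
    (hloc : ∀ {p : ℕ}, p.Prime → Summable fun n => f (p ^ n)) {t : ℕ → ℝ} (ht : Summable t)
    (ht₀ : ∀ n, 0 ≤ t n) (hle : ∀ {p : ℕ}, p.Prime → ∑' n, f (p ^ n) ≤ 1 + t p) :
    Summable f := by
  refine summable_of_sum_range_le (c := Real.exp (∑' n, t n)) hf fun N => ?_
  have key := (EulerProduct.summable_and_hasSum_smoothNumbers_prod_primesBelow_tsum hf₁ hmul
    (fun hp => by simpa only [Real.norm_of_nonneg (hf _)] using hloc hp) N).2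
  have h1 : ∑ n ∈ Finset.range N, f n =
      ∑ n ∈ (Finset.range N).subtype (· ∈ N.smoothNumbers), f n := by
    rw [Finset.sum_subtype_eq_sum_filter, Finset.sum_filter]
    refine Finset.sum_congr rfl fun n hn => ?_
    rcases Nat.eq_zero_or_pos n with rfl | hpos
    · simp [hf₀]
    · rw [if_pos (Nat.mem_smoothNumbers_of_lt hpos (Finset.mem_range.1 hn))]
  rw [h1]
  refine (sum_le_hasSum (f := fun m : N.smoothNumbers => f m) _ (fun i _ => hf i) key).trans ?_
  calc ∏ p ∈ N.primesBelow, ∑' n, f (p ^ n)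
      ≤ ∏ p ∈ N.primesBelow, Real.exp (t p) := by
        refine Finset.prod_le_prod (fun p _ => tsum_nonneg fun n => hf _) fun p hp => ?_
        refine (hle (Nat.prime_of_mem_primesBelow hp)).trans ?_
        linarith [Real.add_one_le_exp (t p)]
    _ = Real.exp (∑ p ∈ N.primesBelow, t p) := (Real.exp_sum _ _).symm
    _ ≤ Real.exp (∑' n, t n) := Real.exp_le_exp.2 (ht.sum_le_tsum _ fun n _ => ht₀ n)

theorem aCoef_zero : aCoef 0 = 0 := by simp [aCoef]

theorem aCoef_one : aCoef 1 = 1 := by simp [aCoef]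

theorem aCoef_mul {m n : ℕ} (h : m.Coprime n) : aCoef (m * n) = aCoef m * aCoef n := by
  rcases eq_or_ne m 0 with rfl | hm
  · simp [aCoef_zero]
  rcases eq_or_ne n 0 with rfl | hn
  · simp [aCoef_zero]
  rw [aCoef, aCoef, aCoef, if_neg (mul_ne_zero hm hn), if_neg hm, if_neg hn,
    h.primeFactors_mul, Finset.prod_union h.disjoint_primeFactors]
  have hl : ∀ p ∈ m.primeFactors, (m * n).factorization p = m.factorization p := fun p hp =>
    Nat.factorization_eq_of_coprime_left h (Nat.mem_primeFactors_iff_mem_primeFactorsList.1 hp)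
  have hr : ∀ p ∈ n.primeFactors, (m * n).factorization p = n.factorization p := fun p hp =>
    Nat.factorization_eq_of_coprime_right h (Nat.mem_primeFactors_iff_mem_primeFactorsList.1 hp)
  congr 1
  · refine Finset.prod_congr rfl fun p hp => ?_
    rcases eq_or_ne p 2 with rfl | h2
    · simp [hl _ hp]
    · simp [h2, hl _ hp]
  · refine Finset.prod_congr rfl fun p hp => ?_
    rcases eq_or_ne p 2 with rfl | h2
    · simp [hr _ hp]
    · simp [h2, hr _ hp]

theorem aCoef_prime_pow {p : ℕ} (hp : p.Prime) {e : ℕ} (he : e ≠ 0) :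
    aCoef (p ^ e) = if p = 2 then (if e = 1 then (-1/2 : ℝ) else 0)
      else (if e = 1 then 2 / (p * (p - 2) : ℝ)
            else if e = 2 then -1 / (p * (p - 2) : ℝ) else 0) := by
  rw [aCoef, if_neg (pow_ne_zero _ hp.ne_zero), Nat.primeFactors_prime_pow he hp,
    Finset.prod_singleton]
  rcases eq_or_ne p 2 with rfl | h2
  · simp [Nat.factorization_pow, Nat.prime_two.factorization]
  · simp [h2, Nat.factorization_pow, hp.factorization]

theorem aCoef_prime_pow_eq_zero {p : ℕ} (hp : p.Prime) {e : ℕ} (he : e ∉ Finset.range 3) :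
    aCoef (p ^ e) = 0 := by
  rw [Finset.mem_range, not_lt] at he
  rw [aCoef_prime_pow hp (by omega)]
  simp [show e ≠ 1 by omega, show e ≠ 2 by omega]

theorem summable_abs_aCoef_mul_rpow :
    Summable fun n : ℕ => |aCoef n| * (n : ℝ) ^ (1 / 4 : ℝ) := by
  have hz {p : ℕ} (hp : p.Prime) (e : ℕ) (he : e ∉ Finset.range 3) :
      |aCoef (p ^ e)| * ((p ^ e : ℕ) : ℝ) ^ (1 / 4 : ℝ) = 0 := by
    rw [aCoef_prime_pow_eq_zero hp he, abs_zero, zero_mul]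
  refine summable_of_multiplicative (t := fun n : ℕ => 9 * (n : ℝ) ^ (-(3 / 2) : ℝ))
    (fun n => by positivity) (by simp [aCoef_zero]) (by simp [aCoef_one]) (fun {m n} h => ?_)
    (fun hp => summable_of_ne_finset_zero (hz hp))
    ((Real.summable_nat_rpow.2 (by norm_num)).mul_left 9) (fun n => by positivity) fun {p} hp => ?_
  · rw [aCoef_mul h, abs_mul, Nat.cast_mul, Real.mul_rpow (by positivity) (by positivity)]
    ring
  · have hp0 : (0 : ℝ) < p := by exact_mod_cast hp.pos
    have hp1 : (1 : ℝ) ≤ p := by exact_mod_cast hp.one_le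
    have hmono : (p : ℝ) ^ (1 / 4 : ℝ) ≤ (p : ℝ) ^ (1 / 2 : ℝ) :=
      Real.rpow_le_rpow_of_exponent_le hp1 (by norm_num)
    have hsq : ((p : ℝ) ^ 2) ^ (1 / 4 : ℝ) = (p : ℝ) ^ (1 / 2 : ℝ) := by
      rw [← Real.rpow_natCast, ← Real.rpow_mul hp0.le]; norm_num
    have hthree : (p : ℝ) ^ (-(3 / 2) : ℝ) = (p : ℝ) ^ (1 / 2 : ℝ) / (p : ℝ) ^ 2 := by
      rw [← Real.rpow_natCast, ← Real.rpow_sub hp0]; norm_num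
    have hhalf : (0 : ℝ) < (p : ℝ) ^ (1 / 2 : ℝ) := by positivity
    rw [tsum_eq_sum (hz hp), Finset.sum_range_succ, Finset.sum_range_succ, Finset.sum_range_one,
      aCoef_prime_pow hp one_ne_zero, aCoef_prime_pow hp two_ne_zero, hthree]
    rcases eq_or_ne p 2 with rfl | h2
    · push_cast at hmono hhalf
      norm_num [aCoef_one]
      linarith
    · have hp3 : (3 : ℝ) ≤ p := by
        have : 3 ≤ p := by have := hp.two_le; omega
        exact_mod_cast this
      have hpos : (0 : ℝ) < p * (p - 2) := by nlinarith
      have hA : 1 / ((p : ℝ) * (p - 2)) ≤ 3 / (p : ℝ) ^ 2 := by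
        rw [div_le_div_iff₀ hpos (by positivity)]
        nlinarith
      have hA0 : 0 < 1 / ((p : ℝ) * (p - 2)) := by positivity
      have e1 : |2 / ((p : ℝ) * (p - 2))| = 2 * (1 / ((p : ℝ) * (p - 2))) := by
        rw [abs_of_pos (by positivity)]; ring
      have e2 : |-1 / ((p : ℝ) * (p - 2))| = 1 / ((p : ℝ) * (p - 2)) := by
        rw [neg_div, abs_neg, abs_of_pos hA0]
      simp only [pow_zero, pow_one, h2, if_true, if_false, aCoef_one, abs_one, Nat.cast_one,
        Real.one_rpow, mul_one, Nat.cast_pow, hsq, e1, OfNat.ofNat_ne_one, e2]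
      set A := 1 / ((p : ℝ) * (p - 2))
      have h5 : 2 * A * (p : ℝ) ^ (1 / 4 : ℝ) ≤ 2 * A * (p : ℝ) ^ (1 / 2 : ℝ) := by gcongr
      have h6 : A * (p : ℝ) ^ (1 / 2 : ℝ) ≤ 3 / (p : ℝ) ^ 2 * (p : ℝ) ^ (1 / 2 : ℝ) := by gcongr
      have h7 : 9 * ((p : ℝ) ^ (1 / 2 : ℝ) / (p : ℝ) ^ 2) =
        3 * (3 / (p : ℝ) ^ 2 * (p : ℝ) ^ (1 / 2 : ℝ)) := by ring
      rw [h7]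
      linarith

theorem summable_norm_aCoef_mul {q : ℕ} (χ : DirichletCharacter ℂ q) :
    Summable fun n : ℕ => ‖(aCoef n : ℂ) * χ (n : ZMod q)‖ := by
  refine summable_abs_aCoef_mul_rpow.of_nonneg_of_le (fun _ => norm_nonneg _) fun n => ?_
  rw [norm_mul, Complex.norm_real, Real.norm_eq_abs]
  rcases eq_or_ne n 0 with rfl | hn
  · simp [aCoef_zero]
  · refine mul_le_mul_of_nonneg_left ((χ.norm_le_one _).trans ?_) (abs_nonneg _)
    exact Real.one_le_rpow (by exact_mod_cast Nat.one_le_iff_ne_zero.2 hn) (by norm_num)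

theorem multipliable_Cq_factor (q : ℕ) : Multipliable fun p : Nat.Primes =>
    if (p : ℕ) = 2 ∨ (p : ℕ) ∣ q then (1 : ℝ) else 1 - 1 / ((p : ℝ) - 1) ^ 2 := by
  have h : Summable fun p : Nat.Primes =>
      if (p : ℕ) = 2 ∨ (p : ℕ) ∣ q then (0 : ℝ) else -(1 / ((p : ℝ) - 1) ^ 2) := by
    have hs : Summable fun p : Nat.Primes => 4 * (1 / ((p : ℕ) : ℝ) ^ 2) :=
      ((Real.summable_one_div_nat_pow.2 one_lt_two).mul_left 4).comp_injective
        Subtype.val_injective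
    refine hs.of_norm_bounded fun p => ?_
    have hp : (2 : ℝ) ≤ p := by exact_mod_cast p.2.two_le
    split_ifs
    · rw [norm_zero]; positivity
    · rw [norm_neg, Real.norm_of_nonneg (by positivity), mul_one_div,
        div_le_div_iff₀ (by nlinarith) (by positivity)]
      nlinarith
  refine (Real.multipliable_one_add_of_summable h).congr fun p => ?_
  split_ifs <;> ring

theorem Cq_nonneg_and_le_two (q : ℕ) : 0 ≤ Cq q ∧ Cq q ≤ 2 := by
  have hfac (p : Nat.Primes) :
      0 ≤ (if (p : ℕ) = 2 ∨ (p : ℕ) ∣ q then (1 : ℝ) else 1 - 1 / ((p : ℝ) - 1) ^ 2) ∧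
      (if (p : ℕ) = 2 ∨ (p : ℕ) ∣ q then (1 : ℝ) else 1 - 1 / ((p : ℝ) - 1) ^ 2) ≤ 1 := by
    have hp : (2 : ℝ) ≤ p := by exact_mod_cast p.2.two_le
    split_ifs
    · norm_num
    · have : 1 / ((p : ℝ) - 1) ^ 2 ≤ 1 := by
        rw [div_le_one (by nlinarith)]
        nlinarith
      have : 0 ≤ 1 / ((p : ℝ) - 1) ^ 2 := by positivity
      constructor <;> linarith
  have h := (multipliable_Cq_factor q).hasProd
  have h0 := ge_of_tendsto' h fun s => Finset.prod_nonneg fun p _ => (hfac p).1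
  have h1 := le_of_tendsto' h fun s =>
    Finset.prod_le_one (fun p _ => (hfac p).1) fun p _ => (hfac p).2
  rw [Cq]
  constructor <;> linarith

theorem Aq_eq {q : ℕ} (hq : Odd q) (χ : DirichletCharacter ℂ q) :
    Aq q χ = Cq q * χ 2 * ∑' n : ℕ, (aCoef n : ℂ) * χ (n : ZMod q) := by
  have hE := EulerProduct.eulerProduct_hasProd (f := fun n : ℕ => (aCoef n : ℂ) * χ (n : ZMod q))
    (by simp [aCoef_one]) (fun {m n} h => by
      simp only [aCoef_mul h, Nat.cast_mul, map_mul, Complex.ofReal_mul]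
      ring) (summable_norm_aCoef_mul χ) (by simp [aCoef_zero])
  have hG : HasProd (fun p : Nat.Primes => (((if (p : ℕ) = 2 ∨ (p : ℕ) ∣ q then (1 : ℝ)
      else 1 - 1 / ((p : ℝ) - 1) ^ 2 : ℝ)) : ℂ)) _ :=
    (multipliable_Cq_factor q).hasProd.map Complex.ofRealHom Complex.continuous_ofReal
  have hH : HasProd (fun p : Nat.Primes => if (p : ℕ) = 2 then 2 * χ 2 else 1) (2 * χ 2) :=
    (hasProd_ite_eq (⟨2, Nat.prime_two⟩ : Nat.Primes) (2 * χ 2)).congr_fun fun p =>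
      if_congr ⟨fun h => Subtype.ext h, fun h => congrArg Subtype.val h⟩ rfl rfl
  have hprod := (hG.mul hH).mul hE
  rw [Aq]
  refine (hprod.congr_fun fun p => ?_).tprod_eq.trans ?_
  · have hp : (p : ℕ).Prime := p.2
    generalize (p : ℕ) = p at hp ⊢
    have hp0 : (p : ℂ) ≠ 0 := by exact_mod_cast hp.ne_zero
    have hloc : ∑' e : ℕ, (aCoef (p ^ e) : ℂ) * χ ((p ^ e : ℕ) : ZMod q) =
        1 + aCoef (p ^ 1) * χ p + aCoef (p ^ 2) * χ p ^ 2 := by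
      rw [tsum_eq_sum (s := Finset.range 3) fun e he => by
        rw [aCoef_prime_pow_eq_zero hp he, Complex.ofReal_zero, zero_mul]]
      simp [Finset.sum_range_succ, aCoef_one]
    rw [hloc, aCoef_prime_pow hp one_ne_zero, aCoef_prime_pow hp two_ne_zero]
    by_cases hpq : p ∣ q
    · have hp2 : p ≠ 2 := by
        rintro rfl
        exact Nat.not_even_iff_odd.2 hq (even_iff_two_dvd.2 hpq)
      have hχ : χ (p : ZMod q) = 0 := by
        refine χ.map_nonunit fun h => ?_
        rw [ZMod.isUnit_iff_coprime] at h
        exact (Nat.Prime.coprime_iff_not_dvd hp).1 h hpq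
      simp [hpq, hp2, hχ]
    · rcases eq_or_ne p 2 with rfl | hp2
      · simp [hpq]
        ring
      · have h1 : (p : ℂ) - 1 ≠ 0 := sub_ne_zero.2 (by exact_mod_cast hp.one_lt.ne')
        have h2 : (p : ℂ) - 2 ≠ 0 := sub_ne_zero.2 (by exact_mod_cast hp2)
        simp only [hpq, hp2, if_false, if_true, or_self, OfNat.ofNat_ne_one]
        push_cast
        field_simp
        ring
  · rw [Cq, Complex.ofRealHom_eq_coe]
    push_cast
    ring

theorem sum_bCoef_mul {q : ℕ} (χ : DirichletCharacter ℂ q) (N : ℕ) :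
    ∑ n ∈ Finset.Icc 1 N, (bCoef n : ℂ) * χ (n : ZMod q) =
      ∑ u ∈ Finset.Icc 1 N, (aCoef u : ℂ) * χ (u : ZMod q) *
        ∑ i ∈ Finset.range (N / u + 1), χ (i : ZMod q) / i := by
  let F : ArithmeticFunction ℂ := ⟨fun n => (aCoef n : ℂ) * χ (n : ZMod q), by simp [aCoef_zero]⟩
  let G : ArithmeticFunction ℂ := ⟨fun n => χ (n : ZMod q) / n, by simp⟩
  have hI (M : ℕ) : Finset.Icc 1 M = Finset.Ioc 0 M := rfl
  have hFG (n : ℕ) : (F * G) n = (bCoef n : ℂ) * χ (n : ZMod q) := by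
    rw [ArithmeticFunction.mul_apply, bCoef,
      Nat.sum_divisorsAntidiagonal (fun u v => F u * G v), Complex.ofReal_sum, Finset.sum_mul]
    refine Finset.sum_congr rfl fun u hu => ?_
    have h : χ (n : ZMod q) = χ (u : ZMod q) * χ ((n / u : ℕ) : ZMod q) := by
      rw [← map_mul, ← Nat.cast_mul, Nat.mul_div_cancel' (Nat.dvd_of_mem_divisors hu)]
    change (aCoef u : ℂ) * χ (u : ZMod q) * (χ ((n / u : ℕ) : ZMod q) / ((n / u : ℕ) : ℂ)) = _
    rw [h]
    push_cast
    ring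
  rw [hI, Finset.sum_congr rfl fun n _ => (hFG n).symm, ArithmeticFunction.sum_Ioc_mul_eq_sum_sum]
  refine Finset.sum_congr rfl fun u _ => ?_
  change _ * ∑ m ∈ Finset.Ioc 0 (N / u), χ (m : ZMod q) / (m : ℂ) = _
  rw [Finset.range_eq_Ico, Finset.sum_eq_sum_Ico_succ_bot (Nat.succ_pos _), Nat.cast_zero,
    Nat.cast_zero, div_zero, zero_add]
  rfl

theorem norm_LFunction_one_mul_sub_sum_le {q : ℕ} [NeZero q] {χ : DirichletCharacter ℂ q}
    (hχ : χ ≠ 1) {N : ℕ} (hN : 1 ≤ N) :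
    ‖DirichletCharacter.LFunction χ 1 * ∑' n : ℕ, (aCoef n : ℂ) * χ (n : ZMod q) -
        ∑ n ∈ Finset.Icc 1 N, (bCoef n : ℂ) * χ (n : ZMod q)‖ ≤
      8 * (q : ℝ) ^ (1 / 2 : ℝ) * (N : ℝ) ^ (-(1 / 4) : ℝ) *
        ∑' n : ℕ, |aCoef n| * (n : ℝ) ^ (1 / 4 : ℝ) := by
  have hD := (summable_norm_aCoef_mul χ).of_norm.hasSum.mul_left
    (DirichletCharacter.LFunction χ 1)
  have hS : HasSum (fun u : ℕ => (aCoef u : ℂ) * χ (u : ZMod q) *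
      ∑ i ∈ Finset.range (N / u + 1), χ (i : ZMod q) / i)
      (∑ n ∈ Finset.Icc 1 N, (bCoef n : ℂ) * χ (n : ZMod q)) := by
    rw [sum_bCoef_mul]
    refine hasSum_sum_of_ne_finset_zero fun u hu => ?_
    rcases Nat.eq_zero_or_pos u with rfl | hpos
    · simp [aCoef_zero]
    · have : N < u := by
        rw [Finset.mem_Icc] at hu
        omega
      simp [Nat.div_eq_of_lt this]
  refine (hD.sub hS).norm_le_of_bounded
    (summable_abs_aCoef_mul_rpow.hasSum.mul_left _) fun u => ?_
  rcases Nat.eq_zero_or_pos u with rfl | hpos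
  · simp [aCoef_zero]
  rw [show DirichletCharacter.LFunction χ 1 * ((aCoef u : ℂ) * χ (u : ZMod q)) -
      (aCoef u : ℂ) * χ (u : ZMod q) * ∑ i ∈ Finset.range (N / u + 1), χ (i : ZMod q) / i =
      (aCoef u : ℂ) * (χ (u : ZMod q) * (DirichletCharacter.LFunction χ 1 -
        ∑ i ∈ Finset.range (N / u + 1), χ (i : ZMod q) / i)) by ring,
    norm_mul, norm_mul, Complex.norm_real, Real.norm_eq_abs]
  have hN0 : (0 : ℝ) < N := by exact_mod_cast hN
  have hu0 : (0 : ℝ) < u := by exact_mod_cast hpos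
  have h1 := norm_LFunction_one_sub_le_rpow hχ (Nat.succ_pos (N / u))
  have h2 : (((N / u).succ : ℕ) : ℝ) ^ (-(1 / 4) : ℝ) ≤
      (N : ℝ) ^ (-(1 / 4) : ℝ) * (u : ℝ) ^ (1 / 4 : ℝ) := by
    have h3 : ((N : ℝ) / u) ≤ ((N / u).succ : ℕ) := by
      rw [div_le_iff₀ hu0]
      have := (Nat.lt_mul_div_succ N hpos).le
      rw [mul_comm] at this
      exact_mod_cast this
    refine (Real.rpow_le_rpow_of_nonpos (by positivity) h3 (by norm_num)).trans_eq ?_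
    rw [Real.div_rpow hN0.le hu0.le, Real.rpow_neg hu0.le, div_inv_eq_mul]
  have h4 : ‖χ (u : ZMod q)‖ ≤ 1 := χ.norm_le_one _
  calc |aCoef u| * (‖χ (u : ZMod q)‖ * ‖DirichletCharacter.LFunction χ 1 -
        ∑ i ∈ Finset.range (N / u + 1), χ (i : ZMod q) / i‖)
      ≤ |aCoef u| * (1 * (8 * (q : ℝ) ^ (1 / 2 : ℝ) *
          ((N : ℝ) ^ (-(1 / 4) : ℝ) * (u : ℝ) ^ (1 / 4 : ℝ)))) := by
        gcongr
        exact h1.trans (by gcongr)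
    _ = _ := by ring

theorem sum_characters_mul_eq {q : ℕ} [Fact q.Prime] (hq : Odd q) (k : ℤ) (n : ℕ) :
    ∑ χ : DirichletCharacter ℂ q, (starRingEnd ℂ) (χ (k : ZMod q)) *
        DirichletCharacter.LFunction χ 0 * (χ 2 * χ (n : ZMod q)) =
      -(q.totient * ((if n.Coprime q then saw (((k * invMod q (2 * n) : ℤ) : ℝ) / q) else 0 : ℝ)
        : ℂ)) := by
  have hq1 : q ≠ 1 := (Fact.out : q.Prime).ne_one
  have hstar (χ : DirichletCharacter ℂ q) :
      (starRingEnd ℂ) (χ (k : ZMod q)) = χ (k : ZMod q)⁻¹ := by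
    rw [starRingEnd_apply, MulChar.star_apply', MulChar.inv_apply']
  have hsaw : saw (((k * invMod q (2 * n) : ℤ) : ℝ) / q) =
      sawZMod q ((k : ZMod q) * (2 * n : ZMod q)⁻¹) := by
    rw [saw_int_div, invMod]
    simp
  have h2 : (2 : ZMod q) ≠ 0 := by
    intro h
    have h' : ((2 : ℕ) : ZMod q) = 0 := by exact_mod_cast h
    rw [ZMod.natCast_eq_zero_iff] at h'
    have := (Nat.prime_dvd_prime_iff_eq (Fact.out : q.Prime) Nat.prime_two).1 h'
    subst this
    exact absurd hq (by decide)
  rw [hsaw]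
  rcases eq_or_ne (k : ZMod q) 0 with hk | hk
  · rw [hk, zero_mul, sawZMod_zero]
    simp [MulChar.map_zero]
  have hswap : ∑ χ : DirichletCharacter ℂ q, (starRingEnd ℂ) (χ (k : ZMod q)) *
        DirichletCharacter.LFunction χ 0 * (χ 2 * χ (n : ZMod q)) =
      -∑ a : ZMod q, (sawZMod q a : ℂ) *
        ∑ χ : DirichletCharacter ℂ q, χ (k : ZMod q)⁻¹ * χ (a * (2 * n)) := by
    simp only [Finset.mul_sum]
    rw [Finset.sum_comm, ← Finset.sum_neg_distrib]
    refine Finset.sum_congr rfl fun χ _ => ?_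
    rw [hstar, LFunction_zero_eq hq1, mul_neg, neg_mul, Finset.mul_sum, Finset.sum_mul]
    congr 1
    refine Finset.sum_congr rfl fun a _ => ?_
    rw [map_mul, map_mul]
    ring
  rw [hswap]
  simp only [DirichletCharacter.sum_char_inv_mul_char_eq ℂ (isUnit_iff_ne_zero.2 hk)]
  congr 1
  split_ifs with hn
  · have hn0 : (n : ZMod q) ≠ 0 := ((ZMod.isUnit_iff_coprime n q).2 hn).ne_zero
    have h_two_mul : (2 * n : ZMod q) ≠ 0 := mul_ne_zero h2 hn0
    rw [Finset.sum_eq_single ((k : ZMod q) * (2 * n : ZMod q)⁻¹)]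
    · rw [if_pos (by rw [mul_assoc, inv_mul_cancel₀ h_two_mul, mul_one])]
      ring
    · intro a _ ha
      rw [if_neg, mul_zero]
      intro h
      rw [h, mul_assoc, mul_inv_cancel₀ h_two_mul, mul_one] at ha
      exact ha rfl
    · simp
  · have hn0 : (n : ZMod q) = 0 := by
      by_contra h
      exact hn ((ZMod.isUnit_iff_coprime n q).1 (isUnit_iff_ne_zero.2 h))
    simp [hn0, hk]

theorem LFunction_one_character_zero {q : ℕ} [Fact q.Prime] :
    DirichletCharacter.LFunction (1 : DirichletCharacter ℂ q) 0 = 0 := by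
  rw [LFunction_zero_eq (Fact.out : q.Prime).ne_one, neg_eq_zero]
  have h (a : ZMod q) : (1 : DirichletCharacter ℂ q) a * (sawZMod q a : ℂ) = sawZMod q a := by
    rcases eq_or_ne a 0 with rfl | ha
    · simp [sawZMod_zero]
    · rw [MulChar.one_apply (isUnit_iff_ne_zero.2 ha), one_mul]
  simp only [h]
  rw [← Complex.ofReal_sum, sum_sawZMod, Complex.ofReal_zero]

theorem sum_nonprincipal_mul_eq {q : ℕ} [Fact q.Prime] (hq : Odd q) (k : ℤ) (N : ℕ) :
    (q.totient : ℂ)⁻¹ * ∑ χ ∈ Finset.univ.filter (fun χ : DirichletCharacter ℂ q => χ ≠ 1),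
        (starRingEnd ℂ) (χ (k : ZMod q)) * DirichletCharacter.LFunction χ 0 *
          (Cq q * χ 2 * ∑ n ∈ Finset.Icc 1 N, (bCoef n : ℂ) * χ (n : ZMod q)) =
      ((-(Cq q * ∑ n ∈ Finset.Icc 1 N, (if Nat.Coprime n q then
        bCoef n * saw (((k * invMod q (2 * n) : ℤ) : ℝ) / q) else 0)) : ℝ) : ℂ) := by
  have hφ : (q.totient : ℂ) ≠ 0 := by
    exact_mod_cast (Nat.totient_pos.2 (Fact.out : q.Prime).pos).ne'
  rw [Finset.sum_filter_of_ne (p := fun χ : DirichletCharacter ℂ q => χ ≠ 1)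
    fun χ _ h hχ => h (by rw [hχ, LFunction_one_character_zero, mul_zero, zero_mul])]
  have hswap : ∑ χ : DirichletCharacter ℂ q,
        (starRingEnd ℂ) (χ (k : ZMod q)) * DirichletCharacter.LFunction χ 0 *
          (Cq q * χ 2 * ∑ n ∈ Finset.Icc 1 N, (bCoef n : ℂ) * χ (n : ZMod q)) =
      Cq q * ∑ n ∈ Finset.Icc 1 N, (bCoef n : ℂ) *
        ∑ χ : DirichletCharacter ℂ q, (starRingEnd ℂ) (χ (k : ZMod q)) *
          DirichletCharacter.LFunction χ 0 * (χ 2 * χ (n : ZMod q)) := by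
    simp only [Finset.mul_sum]
    rw [Finset.sum_comm]
    refine Finset.sum_congr rfl fun χ _ => Finset.sum_congr rfl fun n _ => ?_
    ring
  rw [hswap, Complex.ofReal_neg, Complex.ofReal_mul, Complex.ofReal_sum, mul_left_comm,
    ← mul_neg, ← Finset.sum_neg_distrib, Finset.mul_sum]
  congr 1
  refine Finset.sum_congr rfl fun n _ => ?_
  rw [sum_characters_mul_eq hq]
  split_ifs
  · push_cast
    field_simp
  · simp

/-- Approximation of `C(k)` by a truncated sawtooth sum (Lemma 2.2). -/
theorem C_truncated_approximation :
    ∀ ε : ℝ, 0 < ε → ∃ A : ℝ, ∀ q : ℕ, q.Prime → Odd q → ∀ k : ℤ, ∀ N : ℕ, 1 ≤ N →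
      |Cfun q k + Cq q * ∑ n ∈ Finset.Icc 1 N,
          (if Nat.Coprime n q then
            bCoef n * saw (((k * invMod q (2 * n) : ℤ) : ℝ) / q) else 0)| ≤
        A * (q : ℝ) ^ ((3 : ℝ)/2 + ε) * (N : ℝ) ^ (-(1/4 : ℝ) + ε) := by
  intro ε hε
  set K := ∑' n : ℕ, |aCoef n| * (n : ℝ) ^ (1 / 4 : ℝ)
  have hK0 : 0 ≤ K := tsum_nonneg fun n => by positivity
  refine ⟨16 * K, fun q hq hodd k N hN => ?_⟩
  have : Fact q.Prime := ⟨hq⟩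
  have hq1 : (1 : ℝ) ≤ q := by exact_mod_cast hq.one_le
  have hq0 : (0 : ℝ) < q := by positivity
  have hN1 : (1 : ℝ) ≤ N := by exact_mod_cast hN
  have hφ : (0 : ℝ) < q.totient := by exact_mod_cast Nat.totient_pos.2 hq.pos
  have hCq := Cq_nonneg_and_le_two q
  have hre := congrArg Complex.re (sum_nonprincipal_mul_eq hodd k N)
  rw [Complex.ofReal_re, ← neg_eq_iff_eq_neg] at hre
  rw [← hre, ← sub_eq_add_neg, Cfun, dif_neg hq.ne_zero, ← Complex.sub_re, ← mul_sub,
    ← Finset.sum_sub_distrib]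
  refine (Complex.abs_re_le_norm _).trans ?_
  set E := 16 * K * ((q : ℝ) * (q : ℝ) ^ (1 / 2 : ℝ)) * (N : ℝ) ^ (-(1 / 4) : ℝ) with hE
  have hE0 : 0 ≤ E := by positivity
  have hterm (χ : DirichletCharacter ℂ q) (hχ : χ ≠ 1) :
      ‖(starRingEnd ℂ) (χ (k : ZMod q)) * DirichletCharacter.LFunction χ 0 *
          DirichletCharacter.LFunction χ 1 * Aq q χ -
        (starRingEnd ℂ) (χ (k : ZMod q)) * DirichletCharacter.LFunction χ 0 *
          (Cq q * χ 2 * ∑ n ∈ Finset.Icc 1 N, (bCoef n : ℂ) * χ (n : ZMod q))‖ ≤ E := by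
    have e : (starRingEnd ℂ) (χ (k : ZMod q)) * DirichletCharacter.LFunction χ 0 *
          DirichletCharacter.LFunction χ 1 * Aq q χ -
        (starRingEnd ℂ) (χ (k : ZMod q)) * DirichletCharacter.LFunction χ 0 *
          (Cq q * χ 2 * ∑ n ∈ Finset.Icc 1 N, (bCoef n : ℂ) * χ (n : ZMod q)) =
        (starRingEnd ℂ) (χ (k : ZMod q)) * DirichletCharacter.LFunction χ 0 * Cq q * χ 2 *
          (DirichletCharacter.LFunction χ 1 * ∑' n : ℕ, (aCoef n : ℂ) * χ (n : ZMod q) -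
            ∑ n ∈ Finset.Icc 1 N, (bCoef n : ℂ) * χ (n : ZMod q)) := by
      rw [Aq_eq hodd]; ring
    rw [e, norm_mul, norm_mul, norm_mul, norm_mul, RCLike.norm_conj,
      Complex.norm_of_nonneg hCq.1]
    calc _ ≤ 1 * (q : ℝ) * 2 * 1 * (8 * (q : ℝ) ^ (1 / 2 : ℝ) * (N : ℝ) ^ (-(1 / 4) : ℝ) * K) := by
          gcongr
          · exact hCq.1
          · exact χ.norm_le_one _
          · exact norm_LFunction_zero_le hq.ne_one χ
          · exact hCq.2
          · exact χ.norm_le_one _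
          · exact norm_LFunction_one_mul_sub_sum_le hχ hN
      _ = E := by rw [hE]; ring
  have hsum : ‖(q.totient : ℂ)⁻¹ *
      ∑ χ ∈ Finset.univ.filter (fun χ : DirichletCharacter ℂ q => χ ≠ 1),
        ((starRingEnd ℂ) (χ (k : ZMod q)) * DirichletCharacter.LFunction χ 0 *
          DirichletCharacter.LFunction χ 1 * Aq q χ -
        (starRingEnd ℂ) (χ (k : ZMod q)) * DirichletCharacter.LFunction χ 0 *
          (Cq q * χ 2 * ∑ n ∈ Finset.Icc 1 N, (bCoef n : ℂ) * χ (n : ZMod q)))‖ ≤ E := by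
    rw [norm_mul, norm_inv, Complex.norm_natCast, inv_mul_le_iff₀ hφ]
    refine (norm_sum_le_of_le _ fun χ hχ => hterm χ (Finset.mem_filter.1 hχ).2).trans ?_
    rw [Finset.sum_const, nsmul_eq_mul]
    gcongr
    refine (Finset.card_filter_le _ _).trans_eq ?_
    rw [Finset.card_univ, ← Nat.card_eq_fintype_card,
      DirichletCharacter.card_eq_totient_of_hasEnoughRootsOfUnity ℂ q]
  refine hsum.trans ?_
  have h1 : (q : ℝ) * (q : ℝ) ^ (1 / 2 : ℝ) ≤ (q : ℝ) ^ ((3 : ℝ) / 2 + ε) := by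
    rw [← Real.rpow_one_add' hq0.le (by norm_num)]
    exact Real.rpow_le_rpow_of_exponent_le hq1 (by linarith)
  have h2 : (N : ℝ) ^ (-(1 / 4) : ℝ) ≤ (N : ℝ) ^ (-(1 / 4 : ℝ) + ε) :=
    Real.rpow_le_rpow_of_exponent_le hN1 (by linarith)
  rw [hE]
  gcongr
end
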